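/- Suppose α, β ∈ (0,π) and μ : ℕ → ℝ is a strictly increasing sequence enumerating precisely the eigenvalues of L(q,α,β), with normalized norming constants ãₙ = ∫₀^π φ̃ₙ(x)² dx and b̃ₙ = ∫₀^π ψ̃ₙ(x)² dx, where φ̃ₙ is the solution of −y'' + q y = μₙ y with φ̃ₙ(0) = 1, φ̃ₙ'(0) = −cot α, and ψ̃ₙ is the solution with ψ̃ₙ(π) = 1, ψ̃ₙ'(π) = −cot β. Then 1/b̃₀ = ã₀ / (π²·(∏_{k=1}^∞ (μ_k − μ₀)/k²)²), the infinite product being convergent. -/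

import Mathlib

open Real MeasureTheory Set

noncomputable section

/-- `y` (with derivative `y'`) solves `-y'' + Q y = μ y` on `[0, π]`:
`y` is differentiable with derivative `y'`, and
`y' x = y' 0 + ∫ t in 0..x, (Q t - μ) * y t` for all `x ∈ [0, π]`. -/
def IsSol (Q : ℝ → ℝ) (μ : ℝ) (y y' : ℝ → ℝ) : Prop :=
  (∀ x ∈ Set.Icc (0 : ℝ) π, HasDerivAt y (y' x) x) ∧
  (∀ x ∈ Set.Icc (0 : ℝ) π, y' x = y' 0 + ∫ t in (0 : ℝ)..x, (Q t - μ) * y t)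

/-- `μ` is an eigenvalue of the Sturm–Liouville problem `L(Q, γ, δ)`. -/
def IsEigenvalue (Q : ℝ → ℝ) (γ δ : ℝ) (μ : ℝ) : Prop :=
  ∃ y y' : ℝ → ℝ, IsSol Q μ y y' ∧
    (∃ x ∈ Set.Icc (0 : ℝ) π, y x ≠ 0) ∧
    y 0 * Real.cos γ + y' 0 * Real.sin γ = 0 ∧
    y π * Real.cos δ + y' π * Real.sin δ = 0

open Filter Topology
set_option linter.unusedSimpArgs false
set_option linter.unusedVariables false

/-- complex version of `IsSol` with `p = Q - μ` -/
def CSol (p : ℝ → ℂ) (y y' : ℝ → ℂ) : Prop :=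
  (∀ x ∈ Set.Icc (0 : ℝ) π, HasDerivAt y (y' x) x) ∧
  (∀ x ∈ Set.Icc (0 : ℝ) π, y' x = y' 0 + ∫ t in (0 : ℝ)..x, p t * y t)

lemma zero_mem_I : (0 : ℝ) ∈ Set.Icc (0 : ℝ) π := ⟨le_rfl, pi_pos.le⟩
lemma pi_mem_I : (π : ℝ) ∈ Set.Icc (0 : ℝ) π := ⟨pi_pos.le, le_rfl⟩
lemma uIcc_pi : Set.uIcc (0 : ℝ) π = Set.Icc 0 π := Set.uIcc_of_le pi_pos.le

lemma uIcc_sub {x : ℝ} (hx : x ∈ Set.Icc (0 : ℝ) π) : Set.uIcc 0 x ⊆ Set.uIcc 0 π := by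
  rw [uIcc_pi, Set.uIcc_of_le hx.1]; exact Set.Icc_subset_Icc le_rfl hx.2

lemma CSol.cont {p y y' : ℝ → ℂ} (h : CSol p y y') : ContinuousOn y (Set.Icc 0 π) :=
  fun x hx => (h.1 x hx).continuousAt.continuousWithinAt

lemma CSol.int {p y y' : ℝ → ℂ} (h : CSol p y y') (hp : IntervalIntegrable p volume 0 π) :
    IntervalIntegrable (fun t => p t * y t) volume 0 π :=
  hp.mul_continuousOn (by rw [uIcc_pi]; exact h.cont)

lemma CSol.cont' {p y y' : ℝ → ℂ} (h : CSol p y y') (hp : IntervalIntegrable p volume 0 π) :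
    ContinuousOn y' (Set.Icc 0 π) := by
  have h1 := intervalIntegral.continuousOn_primitive_interval' (h.int hp)
    (a := 0) (by simp)
  rw [uIcc_pi] at h1
  exact (continuousOn_const.add h1).congr (fun x hx => h.2 x hx)

lemma CSol.eq_int {p y y' : ℝ → ℂ} (h : CSol p y y') (hp : IntervalIntegrable p volume 0 π)
    {x : ℝ} (hx : x ∈ Set.Icc (0 : ℝ) π) : y x = y 0 + ∫ t in (0 : ℝ)..x, y' t := by
  rw [intervalIntegral.integral_eq_sub_of_hasDerivAt (f := y)]
  · ring
  · intro t ht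
    have := uIcc_sub hx ht
    rw [uIcc_pi] at this
    exact h.1 t this
  · apply ContinuousOn.intervalIntegrable
    refine (h.cont' hp).mono ?_
    rw [← uIcc_pi]; exact uIcc_sub hx

lemma ac_integral {f : ℝ → ℂ} {a b : ℝ} (h : IntervalIntegrable f volume a b) :
    AbsolutelyContinuousOnInterval (fun x => ∫ t in a..x, f t) a b := by
  have hre : IntervalIntegrable (fun t => (f t).re) volume a b := ⟨h.1.re, h.2.re⟩
  have him : IntervalIntegrable (fun t => (f t).im) volume a b := ⟨h.1.im, h.2.im⟩
  have c1 : AbsolutelyContinuousOnInterval (fun _ : ℝ => (1 : ℂ)) a b :=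
    (contDiff_const.contDiffOn).absolutelyContinuousOnInterval
  have c2 : AbsolutelyContinuousOnInterval (fun _ : ℝ => Complex.I) a b :=
    (contDiff_const.contDiffOn).absolutelyContinuousOnInterval
  have h1 := ((hre.absolutelyContinuousOnInterval_intervalIntegral (c := a) (by simp)).smul c1).add
    ((him.absolutelyContinuousOnInterval_intervalIntegral (c := a) (by simp)).smul c2)
  have key : ∀ x ∈ Set.uIcc a b, (∫ t in a..x, f t) =
      ((fun x => ∫ t in a..x, (f t).re) • (fun _ : ℝ => (1 : ℂ)) +
      (fun x => ∫ t in a..x, (f t).im) • (fun _ : ℝ => Complex.I)) x := by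
    intro x hx
    have hs : Set.uIcc a x ⊆ Set.uIcc a b := Set.uIcc_subset_uIcc_left hx
    have hfx := h.mono_set hs
    simp only [Pi.add_apply, Pi.smul_apply', Complex.real_smul, mul_one]
    have e1 := (intervalIntegral.integral_ofReal (μ := volume) (a := a) (b := x)
      (f := fun t => (f t).re))
    have e2 := (intervalIntegral.integral_ofReal (μ := volume) (a := a) (b := x)
      (f := fun t => (f t).im))
    rw [← e1, ← e2]
    rw [← intervalIntegral.integral_mul_const, ← intervalIntegral.integral_add]
    · congr 1; ext t; exact (Complex.re_add_im _).symm
    · exact ⟨(hre.mono_set hs).1.ofReal, (hre.mono_set hs).2.ofReal⟩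
    · have i2 : IntervalIntegrable (fun t => ((f t).im : ℂ)) volume a x :=
        ⟨(him.mono_set hs).1.ofReal, (him.mono_set hs).2.ofReal⟩
      exact i2.mul_const _
  rw [absolutelyContinuousOnInterval_iff] at h1 ⊢
  intro ε hε
  obtain ⟨δ, hδ, H⟩ := h1 ε hε
  refine ⟨δ, hδ, fun E hE hE2 => ?_⟩
  convert H E hE hE2 using 1
  apply Finset.sum_congr rfl
  intro i hi
  rw [key _ (hE.1 i hi).1, key _ (hE.1 i hi).2]

lemma wronskian {p1 p2 y y' z z' : ℝ → ℂ} (hy : CSol p1 y y') (hz : CSol p2 z z')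
    (hp1 : IntervalIntegrable p1 volume 0 π) (hp2 : IntervalIntegrable p2 volume 0 π)
    {b : ℝ} (hb : b ∈ Set.Icc (0 : ℝ) π) :
    y' b * z b - y b * z' b = y' 0 * z 0 - y 0 * z' 0 +
      ∫ t in (0 : ℝ)..b, (p1 t - p2 t) * (y t * z t) := by
  have iy := hy.int hp1
  have iz := hz.int hp2
  have cc : ∀ c : ℂ, AbsolutelyContinuousOnInterval (fun _ : ℝ => c) 0 π := fun c =>
    (contDiff_const.contDiffOn).absolutelyContinuousOnInterval
  have iy' : IntervalIntegrable y' volume 0 π :=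
    ContinuousOn.intervalIntegrable (by rw [uIcc_pi]; exact hy.cont' hp1)
  have iz' : IntervalIntegrable z' volume 0 π :=
    ContinuousOn.intervalIntegrable (by rw [uIcc_pi]; exact hz.cont' hp2)
  have ig : IntervalIntegrable (fun t => (p1 t - p2 t) * (y t * z t)) volume 0 π :=
    (hp1.sub hp2).mul_continuousOn (by rw [uIcc_pi]; exact hy.cont.mul hz.cont)
  set Y1 := fun x => y' 0 + ∫ t in (0:ℝ)..x, p1 t * y t
  set Z1 := fun x => z' 0 + ∫ t in (0:ℝ)..x, p2 t * z t
  set Y := fun x => y 0 + ∫ t in (0:ℝ)..x, y' t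
  set Z := fun x => z 0 + ∫ t in (0:ℝ)..x, z' t
  set G := fun x => ∫ t in (0:ℝ)..x, (p1 t - p2 t) * (y t * z t)
  have aY1 : AbsolutelyContinuousOnInterval Y1 0 π := (cc (y' 0)).add (ac_integral iy)
  have aZ1 : AbsolutelyContinuousOnInterval Z1 0 π := (cc (z' 0)).add (ac_integral iz)
  have aY : AbsolutelyContinuousOnInterval Y 0 π := (cc (y 0)).add (ac_integral iy')
  have aZ : AbsolutelyContinuousOnInterval Z 0 π := (cc (z 0)).add (ac_integral iz')
  have aG : AbsolutelyContinuousOnInterval G 0 π := ac_integral ig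
  have eY1 : ∀ x ∈ Set.Icc (0:ℝ) π, Y1 x = y' x := fun x hx => (hy.2 x hx).symm
  have eZ1 : ∀ x ∈ Set.Icc (0:ℝ) π, Z1 x = z' x := fun x hx => (hz.2 x hx).symm
  have eY : ∀ x ∈ Set.Icc (0:ℝ) π, Y x = y x := fun x hx => (hy.eq_int hp1 hx).symm
  have eZ : ∀ x ∈ Set.Icc (0:ℝ) π, Z x = z x := fun x hx => (hz.eq_int hp2 hx).symm
  have aW := ((aY1.smul aZ).sub (aY.smul aZ1)).sub aG
  obtain ⟨C, hC⟩ := aW.const_of_ae_hasDerivAt_zero (by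
    filter_upwards [iy.ae_hasDerivAt_integral, iz.ae_hasDerivAt_integral,
      iy'.ae_hasDerivAt_integral, iz'.ae_hasDerivAt_integral, ig.ae_hasDerivAt_integral]
      with x h1 h2 h3 h4 h5 hx
    have d1 : HasDerivAt Y1 _ x := (h1 hx 0 (by simp)).const_add (y' 0)
    have d2 : HasDerivAt Z1 _ x := (h2 hx 0 (by simp)).const_add (z' 0)
    have d3 : HasDerivAt Y _ x := (h3 hx 0 (by simp)).const_add (y 0)
    have d4 : HasDerivAt Z _ x := (h4 hx 0 (by simp)).const_add (z 0)
    have d5 : HasDerivAt G _ x := h5 hx 0 (by simp)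
    rw [uIcc_pi] at hx
    have := ((d1.mul d4).sub (d3.mul d2)).sub d5
    refine HasDerivAt.congr_deriv this ?_
    rw [eY1 x hx, eZ1 x hx, eY x hx, eZ x hx]
    ring)
  rw [uIcc_pi] at hC
  have c1 := hC b hb
  have c0 := hC 0 zero_mem_I
  simp only [Pi.sub_apply, Pi.mul_apply, smul_eq_mul, eY1 b hb, eZ1 b hb, eY b hb, eZ b hb, eY1 0 zero_mem_I, eZ1 0 zero_mem_I, eY 0 zero_mem_I, eZ 0 zero_mem_I] at c1 c0
  have g0 : G 0 = 0 := by simp [G]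
  rw [g0] at c0
  change y' b * z b - y b * z' b = y' 0 * z 0 - y 0 * z' 0 + G b
  linear_combination c1 - c0

lemma bndA {P f : ℝ → ℂ} {W M k t : ℝ} (hP : IntervalIntegrable P volume 0 π)
    (hW : (∫ t in (0:ℝ)..π, ‖P t‖) ≤ W) (hM : 0 ≤ M) (hk : 0 < k)
    (hf : ∀ τ ∈ Set.Icc (0:ℝ) π, ‖f τ‖ ≤ M * Real.exp (k * τ)) (ht : t ∈ Set.Icc (0:ℝ) π) :
    ‖∫ τ in (0:ℝ)..t, P τ * f τ‖ ≤ W * M * Real.exp (k * t) := by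
  have hPn : IntervalIntegrable (fun τ => ‖P τ‖) volume 0 π := hP.norm
  have h1 : ‖∫ τ in (0:ℝ)..t, P τ * f τ‖ ≤ ∫ τ in (0:ℝ)..t, ‖P τ‖ * (M * Real.exp (k * t)) := by
    apply intervalIntegral.norm_integral_le_of_norm_le ht.1
    · filter_upwards with τ hτ
      rw [norm_mul]
      have : ‖f τ‖ ≤ M * Real.exp (k * t) := by
        refine (hf τ ⟨hτ.1.le, hτ.2.trans ht.2⟩).trans ?_
        have := hτ.2
        gcongr
      gcongr
    · exact (hPn.mono_set (uIcc_sub ht)).mul_const _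
  refine h1.trans ?_
  rw [intervalIntegral.integral_mul_const, mul_assoc]
  gcongr
  refine le_trans ?_ hW
  exact intervalIntegral.integral_mono_interval le_rfl ht.1 ht.2
    (Filter.Eventually.of_forall fun _ => norm_nonneg _) hPn

lemma bndB {P f : ℝ → ℂ} {W M k x : ℝ} (hP : IntervalIntegrable P volume 0 π)
    (hW : (∫ t in (0:ℝ)..π, ‖P t‖) ≤ W) (hM : 0 ≤ M) (hk : 0 < k)
    (hf : ∀ τ ∈ Set.Icc (0:ℝ) π, ‖f τ‖ ≤ M * Real.exp (k * τ)) (hx : x ∈ Set.Icc (0:ℝ) π) :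
    ‖∫ t in (0:ℝ)..x, ∫ τ in (0:ℝ)..t, P τ * f τ‖ ≤ W * M / k * Real.exp (k * x) := by
  have hW0 : 0 ≤ W := le_trans (intervalIntegral.integral_nonneg pi_pos.le
    (fun _ _ => norm_nonneg _)) hW
  have h1 : ‖∫ t in (0:ℝ)..x, ∫ τ in (0:ℝ)..t, P τ * f τ‖ ≤
      ∫ t in (0:ℝ)..x, W * M * Real.exp (k * t) := by
    apply intervalIntegral.norm_integral_le_of_norm_le hx.1
    · filter_upwards with t ht
      exact bndA hP hW hM hk hf ⟨ht.1.le, ht.2.trans hx.2⟩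
    · exact (by fun_prop : Continuous fun t => W * M * Real.exp (k * t)).intervalIntegrable _ _
  refine h1.trans ?_
  rw [intervalIntegral.integral_const_mul]
  have : ∫ t in (0:ℝ)..x, Real.exp (k * t) = Real.exp (k * x) / k - 1 / k := by
    rw [intervalIntegral.integral_eq_sub_of_hasDerivAt (f := fun t => Real.exp (k * t) / k)]
    · simp
    · intro t _
      have := (((hasDerivAt_id t).const_mul k).exp).div_const k
      refine this.congr_deriv ?_
      simp; field_simp
    · exact (by fun_prop : Continuous fun t => Real.exp (k * t)).intervalIntegrable _ _
  rw [this]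
  have hk1 : 0 ≤ 1 / k := by positivity
  have : 0 ≤ W * M := by positivity
  calc W * M * (Real.exp (k * x) / k - 1 / k) ≤ W * M * (Real.exp (k * x) / k) := by
        gcongr; linarith
    _ = _ := by ring

lemma apriori {P f : ℝ → ℂ} {W A : ℝ} (hP : IntervalIntegrable P volume 0 π)
    (hW : (∫ t in (0:ℝ)..π, ‖P t‖) ≤ W) (hA : 0 ≤ A) (hf : ContinuousOn f (Set.Icc 0 π))
    (h : ∀ x ∈ Set.Icc (0:ℝ) π, ‖f x‖ ≤ A + ‖∫ t in (0:ℝ)..x, ∫ τ in (0:ℝ)..t, P τ * f τ‖) :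
    ∀ x ∈ Set.Icc (0:ℝ) π, ‖f x‖ ≤ 2 * A * Real.exp ((2 * W + 1) * π) := by
  have hW0 : 0 ≤ W := le_trans (intervalIntegral.integral_nonneg pi_pos.le
    (fun _ _ => norm_nonneg _)) hW
  set k := 2 * W + 1 with hk
  have hk0 : 0 < k := by positivity
  obtain ⟨x0, hx0, hmax⟩ := isCompact_Icc.exists_isMaxOn ⟨0, zero_mem_I⟩
    (hf.norm.mul (by fun_prop : ContinuousOn (fun x => Real.exp (-(k * x))) (Set.Icc 0 π)))
  set M := ‖f x0‖ * Real.exp (-(k * x0)) with hM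
  have hM0 : 0 ≤ M := by positivity
  have hb : ∀ x ∈ Set.Icc (0:ℝ) π, ‖f x‖ ≤ M * Real.exp (k * x) := by
    intro x hx
    have h1 : ‖f x‖ * Real.exp (-(k * x)) ≤ M := hmax hx
    calc ‖f x‖ = ‖f x‖ * Real.exp (-(k * x)) * Real.exp (k * x) := by
          rw [mul_assoc, ← Real.exp_add]; simp
      _ ≤ _ := by gcongr
  have h2 := (h x0 hx0).trans (add_le_add_right (bndB hP hW hM0 hk0 hb hx0) A)
  have h3 : M ≤ A + M / 2 := by
    have e1 : Real.exp (-(k * x0)) ≤ 1 := by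
      rw [Real.exp_le_one_iff]; have := hx0.1; have := mul_nonneg hk0.le this; linarith
    calc M ≤ (A + W * M / k * Real.exp (k * x0)) * Real.exp (-(k * x0)) := by
          rw [hM]; gcongr
      _ = A * Real.exp (-(k * x0)) + W * M / k := by
          rw [add_mul, mul_assoc (W * M / k), ← Real.exp_add]; simp
      _ ≤ A * 1 + M / 2 := by
          have : W * M / k ≤ M / 2 := by
            rw [div_le_div_iff₀ hk0 two_pos]; nlinarith
          gcongr
      _ = _ := by ring
  intro x hx
  calc ‖f x‖ ≤ M * Real.exp (k * x) := hb x hx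
    _ ≤ 2 * A * Real.exp (k * π) := by
      have := hx.2
      gcongr
      linarith

lemma csol_exists {p : ℝ → ℂ} (hp : IntervalIntegrable p volume 0 π) (y0 y1 : ℂ) :
    ∃ y y', CSol p y y' ∧ y 0 = y0 ∧ y' 0 = y1 := by
  set P : ℝ → ℂ := (Set.Ioc (0:ℝ) π).indicator p with hPdef
  have hPi : Integrable P := by
    rw [hPdef, integrable_indicator_iff measurableSet_Ioc]
    exact (intervalIntegrable_iff_integrableOn_Ioc_of_le pi_pos.le).1 hp
  have hPI : ∀ a b, IntervalIntegrable P volume a b := fun a b => hPi.intervalIntegrable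
  set W := ∫ t in (0:ℝ)..π, ‖P t‖ with hW
  have hW0 : 0 ≤ W := intervalIntegral.integral_nonneg pi_pos.le (fun _ _ => norm_nonneg _)
  set k := 2 * W + 1 with hk
  have hk0 : 0 < k := by positivity
  let F : C(Set.Icc (0:ℝ) π, ℂ) → ℝ → ℂ := fun g τ =>
    (Real.exp (k * τ) : ℂ) * Set.IccExtend pi_pos.le g τ
  have hF : ∀ g, Continuous (F g) := fun g => by
    have : Continuous (Set.IccExtend pi_pos.le g) := g.continuous.Icc_extend'
    exact (by fun_prop : Continuous fun τ : ℝ => (Real.exp (k * τ) : ℂ)).mul this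
  have hPF : ∀ g a b, IntervalIntegrable (fun τ => P τ * F g τ) volume a b := fun g a b =>
    (hPI a b).mul_continuousOn (hF g).continuousOn
  let J : C(Set.Icc (0:ℝ) π, ℂ) → ℝ → ℂ := fun g t => y1 + ∫ τ in (0:ℝ)..t, P τ * F g τ
  have hJ : ∀ g, Continuous (J g) := fun g =>
    continuous_const.add (intervalIntegral.continuous_primitive (hPF g) 0)
  let H : C(Set.Icc (0:ℝ) π, ℂ) → ℝ → ℂ := fun g x => y0 + ∫ t in (0:ℝ)..x, J g t
  have hHd : ∀ g x, HasDerivAt (H g) (J g x) x := fun g x =>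
    (intervalIntegral.integral_hasDerivAt_right ((hJ g).intervalIntegrable _ _)
      ((hJ g).stronglyMeasurableAtFilter _ _) (hJ g).continuousAt).const_add y0
  have hH : ∀ g, Continuous (H g) := fun g =>
    continuous_iff_continuousAt.2 fun x => (hHd g x).continuousAt
  let T : C(Set.Icc (0:ℝ) π, ℂ) → C(Set.Icc (0:ℝ) π, ℂ) := fun g =>
    ⟨fun x => (Real.exp (-(k * x)) : ℂ) * H g x, by
      have := hH g
      fun_prop⟩
  have hT : ContractingWith (1/2) T := by
    refine ⟨by norm_num [← NNReal.coe_lt_coe], LipschitzWith.of_dist_le_mul fun g1 g2 => ?_⟩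
    rw [ContinuousMap.dist_le (by positivity)]
    intro x
    have hx := x.2
    set M := dist g1 g2
    have e1 : H g1 x - H g2 x = ∫ t in (0:ℝ)..x, ∫ τ in (0:ℝ)..t, P τ * (F g1 τ - F g2 τ) := by
      simp only [H]
      rw [add_sub_add_left_eq_sub, ← intervalIntegral.integral_sub ((hJ g1).intervalIntegrable _ _)
        ((hJ g2).intervalIntegrable _ _)]
      congr 1; ext t
      simp only [J]
      rw [add_sub_add_left_eq_sub, ← intervalIntegral.integral_sub (hPF _ _ _) (hPF _ _ _)]
      congr 1; ext τ; ring
    have e2 := bndB (P := P) (f := fun τ => F g1 τ - F g2 τ) (W := W) (M := M) (k := k) (x := x)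
      (hPI _ _) le_rfl dist_nonneg hk0 (by
        intro τ hτ
        simp only [F]
        rw [← mul_sub, norm_mul, Complex.norm_real, Real.norm_of_nonneg (Real.exp_pos _).le, mul_comm]
        gcongr
        rw [Set.IccExtend_of_mem _ _ hτ, Set.IccExtend_of_mem _ _ hτ, ← dist_eq_norm]
        exact ContinuousMap.dist_apply_le_dist _) hx
    have e3 : dist (T g1 x) (T g2 x) = Real.exp (-(k * x)) * ‖H g1 x - H g2 x‖ := by
      simp only [T, ContinuousMap.coe_mk]
      rw [dist_eq_norm, ← mul_sub, norm_mul, Complex.norm_real, Real.norm_of_nonneg (Real.exp_pos _).le]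
    rw [e3, e1]
    calc _ ≤ Real.exp (-(k * x)) * (W * M / k * Real.exp (k * x)) := by gcongr
      _ = W * M / k := by
        rw [mul_comm, mul_assoc, ← Real.exp_add]; simp
      _ ≤ _ := by
        have : 0 ≤ M := dist_nonneg
        have h12 : ((1/2 : NNReal) : ℝ) = 1/2 := by norm_num
        rw [h12, div_le_iff₀ hk0]; nlinarith
  set g := hT.fixedPoint T
  have hg : T g = g := hT.fixedPoint_isFixedPt
  have hFH : ∀ x ∈ Set.Icc (0:ℝ) π, F g x = H g x := by
    intro x hx
    simp only [F]
    rw [Set.IccExtend_of_mem _ _ hx]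
    have h1 : g ⟨x, hx⟩ = (Real.exp (-(k * x)) : ℂ) * H g x :=
      (congrArg (fun f : C(Set.Icc (0:ℝ) π, ℂ) => f ⟨x, hx⟩) hg).symm
    rw [h1, ← mul_assoc, ← Complex.ofReal_mul, ← Real.exp_add]; simp
  refine ⟨H g, J g, ⟨fun x _ => hHd g x, fun x hx => ?_⟩, by simp [H], by simp [J]⟩
  have : J g 0 = y1 := by simp [J]
  rw [this]
  simp only [J]
  congr 1
  apply intervalIntegral.integral_congr_ae
  filter_upwards with t ht
  rw [Set.uIoc_of_le hx.1] at ht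
  have ht' : t ∈ Set.Ioc (0:ℝ) π := ⟨ht.1, ht.2.trans hx.2⟩
  rw [hFH t ⟨ht'.1.le, ht'.2⟩, hPdef, Set.indicator_of_mem ht']

lemma wr_const {p y y' z z' : ℝ → ℂ} (hy : CSol p y y') (hz : CSol p z z')
    (hp : IntervalIntegrable p volume 0 π)
    {b : ℝ} (hb : b ∈ Set.Icc (0 : ℝ) π) :
    y' b * z b - y b * z' b = y' 0 * z 0 - y 0 * z' 0 := by
  rw [wronskian hy hz hp hp hb]; simp

lemma CSol.lin {p y y' z z' : ℝ → ℂ} (hy : CSol p y y') (hz : CSol p z z')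
    (hp : IntervalIntegrable p volume 0 π) (a b : ℂ) :
    CSol p (fun x => a * y x + b * z x) (fun x => a * y' x + b * z' x) := by
  refine ⟨fun x hx => ((hy.1 x hx).const_mul a).add ((hz.1 x hx).const_mul b), fun x hx => ?_⟩
  have e : ∀ t, p t * (a * y t + b * z t) = a * (p t * y t) + b * (p t * z t) := fun t => by ring
  simp only [e]
  rw [intervalIntegral.integral_add, intervalIntegral.integral_const_mul,
    intervalIntegral.integral_const_mul, hy.2 x hx, hz.2 x hx]
  · ring
  · exact ((hy.int hp).mono_set (uIcc_sub hx)).const_mul _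
  · exact ((hz.int hp).mono_set (uIcc_sub hx)).const_mul _

lemma csol_zero {p y y' : ℝ → ℂ} (hy : CSol p y y') (hp : IntervalIntegrable p volume 0 π)
    {c : ℝ} (hc : c ∈ Set.Icc (0:ℝ) π) (h0 : y c = 0) (h1 : y' c = 0) :
    ∀ x ∈ Set.Icc (0:ℝ) π, y x = 0 ∧ y' x = 0 := by
  obtain ⟨z1, z1', hz1, a1, a2⟩ := csol_exists hp 1 0
  obtain ⟨z2, z2', hz2, b1, b2⟩ := csol_exists hp 0 1
  intro x hx
  have w1 := wr_const hy hz1 hp hx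
  have w1c := wr_const hy hz1 hp hc
  have w2 := wr_const hy hz2 hp hx
  have w2c := wr_const hy hz2 hp hc
  have w := wr_const hz1 hz2 hp hx
  rw [h0, h1] at w1c w2c
  rw [a1, a2, b1, b2] at w
  rw [← w1c] at w1
  rw [← w2c] at w2
  constructor
  · linear_combination (y x) * w - z1 x * w2 + z2 x * w1
  · linear_combination (y' x) * w - z1' x * w2 + z2' x * w1

lemma csol_unique {p y y' z z' : ℝ → ℂ} (hy : CSol p y y') (hz : CSol p z z')
    (hp : IntervalIntegrable p volume 0 π)
    {c : ℝ} (hc : c ∈ Set.Icc (0:ℝ) π) (h0 : y c = z c) (h1 : y' c = z' c) :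
    ∀ x ∈ Set.Icc (0:ℝ) π, y x = z x ∧ y' x = z' x := by
  intro x hx
  have := csol_zero (hy.lin hz hp 1 (-1)) hp hc (by rw [h0]; ring) (by rw [h1]; ring) x hx
  exact ⟨by linear_combination this.1, by linear_combination this.2⟩

lemma csol_term {p : ℝ → ℂ} (hp : IntervalIntegrable p volume 0 π) (B : ℂ) :
    ∃ y y', CSol p y y' ∧ y π = 1 ∧ y' π = -B := by
  obtain ⟨z1, z1', hz1, a1, a2⟩ := csol_exists hp 1 0
  obtain ⟨z2, z2', hz2, b1, b2⟩ := csol_exists hp 0 1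
  have w := wr_const hz1 hz2 hp pi_mem_I
  rw [a1, a2, b1, b2] at w
  refine ⟨_, _, hz1.lin hz2 hp (z2' π + B * z2 π) (-B * z1 π - z1' π), ?_, ?_⟩
  · linear_combination -w
  · linear_combination B * w

lemma pint {q : ℝ → ℝ} (hq : IntervalIntegrable q volume 0 π) (l : ℂ) :
    IntervalIntegrable (fun t => (q t : ℂ) - l) volume 0 π := by
  have : IntervalIntegrable (fun t => (q t : ℂ)) volume 0 π := ⟨hq.1.ofReal, hq.2.ofReal⟩
  exact this.sub intervalIntegrable_const

def phi (q : ℝ → ℝ) (hq : IntervalIntegrable q volume 0 π) (h : ℝ) (l : ℂ) : ℝ → ℂ :=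
  (csol_exists (pint hq l) 1 h).choose

def phi' (q : ℝ → ℝ) (hq : IntervalIntegrable q volume 0 π) (h : ℝ) (l : ℂ) : ℝ → ℂ :=
  (csol_exists (pint hq l) 1 h).choose_spec.choose

lemma phi_sol (q : ℝ → ℝ) (hq : IntervalIntegrable q volume 0 π) (h : ℝ) (l : ℂ) :
    CSol (fun t => (q t : ℂ) - l) (phi q hq h l) (phi' q hq h l) :=
  (csol_exists (pint hq l) 1 h).choose_spec.choose_spec.1
lemma phi_0 (q : ℝ → ℝ) (hq : IntervalIntegrable q volume 0 π) (h : ℝ) (l : ℂ) :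
    phi q hq h l 0 = 1 :=
  (csol_exists (pint hq l) 1 h).choose_spec.choose_spec.2.1
lemma phi'_0 (q : ℝ → ℝ) (hq : IntervalIntegrable q volume 0 π) (h : ℝ) (l : ℂ) :
    phi' q hq h l 0 = h :=
  (csol_exists (pint hq l) 1 h).choose_spec.choose_spec.2.2

def chi (q : ℝ → ℝ) (hq : IntervalIntegrable q volume 0 π) (h B : ℝ) (l : ℂ) : ℂ :=
  phi' q hq h l π + B * phi q hq h l π

section
variable {q : ℝ → ℝ} (hq : IntervalIntegrable q volume 0 π) (h B : ℝ)

lemma chi_sub {l l0 : ℂ} {z z' : ℝ → ℂ} (hz : CSol (fun t => (q t : ℂ) - l0) z z')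
    (h1 : z π = 1) (h2 : z' π = -B) :
    chi q hq h B l = chi q hq h B l0 - (l - l0) * ∫ t in (0:ℝ)..π, phi q hq h l t * z t := by
  have w1 := wronskian (phi_sol q hq h l) hz (pint hq _) (pint hq _) pi_mem_I
  have w0 := wr_const (phi_sol q hq h l0) hz (pint hq _) pi_mem_I
  rw [phi_0, phi'_0, h1, h2] at w0 w1
  have e : ∀ t, ((q t : ℂ) - l - (q t - l0)) * (phi q hq h l t * z t) =
    (l0 - l) * (phi q hq h l t * z t) := fun t => by ring
  simp only [e, intervalIntegral.integral_const_mul] at w1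
  unfold chi
  linear_combination w1 - w0

lemma phi_lip (l0 : ℂ) : ∃ C, 0 ≤ C ∧ ∀ l, ‖l - l0‖ ≤ 1 → ∀ x ∈ Set.Icc (0:ℝ) π,
    ‖phi q hq h l x - phi q hq h l0 x‖ ≤ C * ‖l - l0‖ := by
  set W := (∫ t in (0:ℝ)..π, ‖(q t : ℂ) - l0‖) + π with hW
  obtain ⟨K, hK⟩ := isCompact_Icc.exists_bound_of_continuousOn (phi_sol q hq h l0).cont
  have hK0 : 0 ≤ K := (norm_nonneg _).trans (hK 0 zero_mem_I)
  refine ⟨2 * (K * π * π) * Real.exp ((2 * W + 1) * π), by positivity, fun l hl x hx => ?_⟩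
  have s1 := phi_sol q hq h l
  have s0 := phi_sol q hq h l0
  have hP := pint hq l
  have hWl : (∫ t in (0:ℝ)..π, ‖(q t : ℂ) - l‖) ≤ W := by
    have i0 : IntervalIntegrable (fun t => ‖(q t : ℂ) - l0‖) volume 0 π := (pint hq l0).norm
    have : (∫ t in (0:ℝ)..π, ‖(q t : ℂ) - l‖) ≤ ∫ t in (0:ℝ)..π, (‖(q t : ℂ) - l0‖ + 1) := by
      apply intervalIntegral.integral_mono_on pi_pos.le hP.norm (i0.add intervalIntegrable_const)
      intro t _
      have e : (q t : ℂ) - l = (q t - l0) - (l - l0) := by ring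
      rw [e]
      exact (norm_sub_le _ _).trans (by gcongr)
    rw [intervalIntegral.integral_add i0 intervalIntegrable_const] at this
    simpa [hW] using this
  have key := apriori (P := fun t => (q t : ℂ) - l) (f := fun x => phi q hq h l x - phi q hq h l0 x)
    (A := ‖l - l0‖ * (K * π * π)) hP hWl (by positivity) (s1.cont.sub s0.cont) (by
      intro x hx
      have cdiff : ContinuousOn (fun t => phi q hq h l t - phi q hq h l0 t) (Set.uIcc 0 π) := by
        rw [uIcc_pi]; exact s1.cont.sub s0.cont
      have iA := hP.mul_continuousOn cdiff
      have iB : IntervalIntegrable (phi q hq h l0) volume 0 π :=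
        ContinuousOn.intervalIntegrable (by rw [uIcc_pi]; exact s0.cont)
      have e1 : ∀ t ∈ Set.Icc (0:ℝ) π, phi' q hq h l t - phi' q hq h l0 t =
          (∫ τ in (0:ℝ)..t, ((q τ : ℂ) - l) * (phi q hq h l τ - phi q hq h l0 τ)) +
          (l0 - l) * ∫ τ in (0:ℝ)..t, phi q hq h l0 τ := by
        intro t ht
        rw [s1.2 t ht, s0.2 t ht, phi'_0, phi'_0, add_sub_add_left_eq_sub,
          ← intervalIntegral.integral_sub ((s1.int (pint hq _)).mono_set (uIcc_sub ht))
          ((s0.int (pint hq _)).mono_set (uIcc_sub ht)), ← intervalIntegral.integral_const_mul,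
          ← intervalIntegral.integral_add]
        · congr 1; ext τ; ring
        · exact iA.mono_set (uIcc_sub ht)
        · exact (iB.mono_set (uIcc_sub ht)).const_mul _
      have cA : ContinuousOn (fun t => ∫ τ in (0:ℝ)..t, ((q τ : ℂ) - l) * (phi q hq h l τ - phi q hq h l0 τ)) (Set.uIcc 0 π) :=
        intervalIntegral.continuousOn_primitive_interval' iA (by simp)
      have cB : ContinuousOn (fun t => ∫ τ in (0:ℝ)..t, phi q hq h l0 τ) (Set.uIcc 0 π) :=
        intervalIntegral.continuousOn_primitive_interval' iB (by simp)
      have e2 : phi q hq h l x - phi q hq h l0 x =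
          (∫ t in (0:ℝ)..x, ∫ τ in (0:ℝ)..t, ((q τ : ℂ) - l) * (phi q hq h l τ - phi q hq h l0 τ)) +
          (l0 - l) * ∫ t in (0:ℝ)..x, ∫ τ in (0:ℝ)..t, phi q hq h l0 τ := by
        have ii : ∀ l, IntervalIntegrable (phi' q hq h l) volume 0 x := fun l =>
          (ContinuousOn.intervalIntegrable (by
            rw [uIcc_pi]; exact (phi_sol q hq h l).cont' (pint hq _)) :
              IntervalIntegrable _ volume 0 π).mono_set (uIcc_sub hx)
        rw [s1.eq_int (pint hq _) hx, s0.eq_int (pint hq _) hx, phi_0, phi_0,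
          add_sub_add_left_eq_sub, ← intervalIntegral.integral_sub (ii _) (ii _),
          ← intervalIntegral.integral_const_mul, ← intervalIntegral.integral_add]
        · apply intervalIntegral.integral_congr
          intro t ht
          have := uIcc_sub hx ht
          rw [uIcc_pi] at this
          exact e1 t this
        · exact (cA.mono (uIcc_sub hx)).intervalIntegrable
        · exact (cB.mono (uIcc_sub hx)).intervalIntegrable.const_mul _
      have e3 : ∀ t ∈ Set.Icc (0:ℝ) π, ‖∫ τ in (0:ℝ)..t, phi q hq h l0 τ‖ ≤ K * π := by
        intro t ht
        refine (intervalIntegral.norm_integral_le_of_norm_le_const (C := K) ?_).trans ?_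
        · intro τ hτ
          rw [Set.uIoc_of_le ht.1] at hτ
          exact hK τ ⟨hτ.1.le, hτ.2.trans ht.2⟩
        · rw [sub_zero, abs_of_nonneg ht.1]; have := ht.2; gcongr
      have e4 : ‖∫ t in (0:ℝ)..x, ∫ τ in (0:ℝ)..t, phi q hq h l0 τ‖ ≤ K * π * π := by
        refine (intervalIntegral.norm_integral_le_of_norm_le_const (C := K * π) ?_).trans ?_
        · intro τ hτ
          rw [Set.uIoc_of_le hx.1] at hτ
          exact e3 τ ⟨hτ.1.le, hτ.2.trans hx.2⟩
        · rw [sub_zero, abs_of_nonneg hx.1]; have := hx.2; gcongr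
      rw [e2, add_comm]
      refine (norm_add_le _ _).trans ?_
      rw [norm_mul, norm_sub_rev]
      gcongr)
  refine (key x hx).trans (le_of_eq (by ring))

lemma chi_hasDerivAt {l0 : ℂ} {z z' : ℝ → ℂ} (hz : CSol (fun t => (q t : ℂ) - l0) z z')
    (h1 : z π = 1) (h2 : z' π = -B) :
    HasDerivAt (chi q hq h B) (-∫ t in (0:ℝ)..π, phi q hq h l0 t * z t) l0 := by
  obtain ⟨C, hC0, hC⟩ := phi_lip hq h l0
  obtain ⟨K, hK⟩ := isCompact_Icc.exists_bound_of_continuousOn hz.cont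
  have hK0 : 0 ≤ K := (norm_nonneg _).trans (hK 0 zero_mem_I)
  have ii : ∀ l, IntervalIntegrable (fun t => phi q hq h l t * z t) volume 0 π := fun l =>
    ContinuousOn.intervalIntegrable (by
      rw [uIcc_pi]; exact (phi_sol q hq h l).cont.mul hz.cont)
  rw [hasDerivAt_iff_isLittleO]
  have hO : (fun l => chi q hq h B l - chi q hq h B l0 -
      (l - l0) • (-∫ t in (0:ℝ)..π, phi q hq h l0 t * z t)) =O[𝓝 l0] fun l => ‖l - l0‖ ^ 2 := by
    apply Asymptotics.IsBigO.of_bound (C * K * π)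
    filter_upwards [Metric.closedBall_mem_nhds l0 one_pos] with l hl
    rw [mem_closedBall_iff_norm] at hl
    rw [chi_sub hq h B hz h1 h2 (l := l)]
    have e : chi q hq h B l0 - (l - l0) * (∫ t in (0:ℝ)..π, phi q hq h l t * z t) - chi q hq h B l0 -
      (l - l0) • (-∫ t in (0:ℝ)..π, phi q hq h l0 t * z t) =
      -(l - l0) * ∫ t in (0:ℝ)..π, (phi q hq h l t - phi q hq h l0 t) * z t := by
      simp only [sub_mul]
      rw [intervalIntegral.integral_sub (ii _) (ii _), smul_eq_mul]
      ring
    rw [e, norm_mul, norm_neg]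
    have : ‖∫ t in (0:ℝ)..π, (phi q hq h l t - phi q hq h l0 t) * z t‖ ≤ C * ‖l - l0‖ * K * π := by
      refine (intervalIntegral.norm_integral_le_of_norm_le_const (C := C * ‖l - l0‖ * K) ?_).trans ?_
      · intro τ hτ
        rw [Set.uIoc_of_le pi_pos.le] at hτ
        rw [norm_mul]
        gcongr
        · exact hC l hl τ ⟨hτ.1.le, hτ.2⟩
        · exact hK τ ⟨hτ.1.le, hτ.2⟩
      · rw [sub_zero, abs_of_nonneg pi_pos.le]
    calc _ ≤ ‖l - l0‖ * (C * ‖l - l0‖ * K * π) := by gcongr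
      _ = C * K * π * ‖‖l - l0‖ ^ 2‖ := by rw [norm_pow, norm_norm]; ring
  refine hO.trans_isLittleO ?_
  have := (Asymptotics.isLittleO_norm_pow_id (E' := ℂ) (n := 2) (by norm_num)).comp_tendsto
    (show Tendsto (fun l => l - l0) (𝓝 l0) (𝓝 0) by
      have : Continuous fun l : ℂ => l - l0 := by fun_prop
      simpa using this.tendsto l0)
  exact this

lemma chi_differentiable : Differentiable ℂ (chi q hq h B) := fun l0 => by
  obtain ⟨z, z', hz, h1, h2⟩ := csol_term (pint hq l0) B
  exact (chi_hasDerivAt hq h B hz h1 h2).differentiableAt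
end

lemma norm_exp_mul_I_le (w : ℂ) : ‖Complex.exp (w * Complex.I)‖ ≤ Real.exp |w.im| := by
  rw [Complex.norm_exp]
  simp
  exact neg_le_abs _

lemma norm_cos_le' (w : ℂ) : ‖Complex.cos w‖ ≤ Real.exp |w.im| := by
  rw [Complex.cos, norm_div]
  have h1 := norm_exp_mul_I_le w
  have h2 := norm_exp_mul_I_le (-w)
  simp only [Complex.neg_im, abs_neg] at h2
  have := norm_add_le (Complex.exp (w * Complex.I)) (Complex.exp (-w * Complex.I))
  simp only [Complex.norm_ofNat]
  linarith

lemma norm_sin_le' (w : ℂ) : ‖Complex.sin w‖ ≤ Real.exp |w.im| := by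
  rw [Complex.sin, norm_div, norm_mul]
  have h1 := norm_exp_mul_I_le w
  have h2 := norm_exp_mul_I_le (-w)
  simp only [Complex.neg_im, abs_neg] at h2
  have := norm_sub_le (Complex.exp (-w * Complex.I)) (Complex.exp (w * Complex.I))
  simp only [Complex.norm_ofNat, Complex.norm_I, mul_one]
  linarith

lemma csol_of_deriv {c : ℂ} {y y' : ℝ → ℂ} (h1 : ∀ x, HasDerivAt y (y' x) x)
    (h2 : ∀ x, HasDerivAt y' (c * y x) x) : CSol (fun _ => c) y y' := by
  refine ⟨fun x _ => h1 x, fun x _ => ?_⟩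
  rw [intervalIntegral.integral_eq_sub_of_hasDerivAt (f := y') (fun t _ => h2 t)]
  · ring
  · have : Continuous y := continuous_iff_continuousAt.2 fun x => (h1 x).continuousAt
    exact (by fun_prop : Continuous fun t => c * y t).intervalIntegrable _ _

lemma trig_sol (s : ℂ) (b : ℝ) (A B : ℂ) : CSol (fun _ => -s ^ 2)
    (fun t : ℝ => A * Complex.cos (s * (b - t)) + B * Complex.sin (s * (b - t)))
    (fun t : ℝ => A * s * Complex.sin (s * (b - t)) - B * s * Complex.cos (s * (b - t))) := by
  have hlin : ∀ x : ℝ, HasDerivAt (fun t : ℝ => s * ((b:ℂ) - t)) (-s) x := by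
    intro x
    have h0 : HasDerivAt (fun t : ℝ => (t : ℂ)) 1 x := Complex.ofRealCLM.hasDerivAt
    exact ((h0.const_sub (b:ℂ)).const_mul s).congr_deriv (by ring)
  have hc : ∀ x : ℝ, HasDerivAt (fun t : ℝ => Complex.cos (s * ((b:ℂ) - t)))
      (s * Complex.sin (s * (b - x))) x := fun x =>
    ((Complex.hasDerivAt_cos _).comp x (hlin x)).congr_deriv (by ring)
  have hs : ∀ x : ℝ, HasDerivAt (fun t : ℝ => Complex.sin (s * ((b:ℂ) - t)))
      (-s * Complex.cos (s * (b - x))) x := fun x =>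
    ((Complex.hasDerivAt_sin _).comp x (hlin x)).congr_deriv (by ring)
  apply csol_of_deriv
  · intro x
    exact (((hc x).const_mul A).add ((hs x).const_mul B)).congr_deriv (by ring)
  · intro x
    exact (((hs x).const_mul (A * s)).sub ((hc x).const_mul (B * s))).congr_deriv (by ring)

lemma im_bound (s : ℂ) {r : ℝ} (hr : 0 ≤ r) : |(s * (r : ℂ)).im| = |s.im| * r := by
  rw [Complex.im_mul_ofReal, abs_mul, abs_of_nonneg hr]

section
variable {q : ℝ → ℝ} (hq : IntervalIntegrable q volume 0 π) (h B : ℝ)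

lemma phi_volterra {s : ℂ} (hs : s ≠ 0) {x : ℝ} (hx : x ∈ Set.Icc (0:ℝ) π) :
    phi q hq h (s ^ 2) x = Complex.cos (s * x) + h * (Complex.sin (s * x) / s) +
      ∫ t in (0:ℝ)..x, q t * (phi q hq h (s ^ 2) t * (Complex.sin (s * (x - t)) / s)) := by
  have w := wronskian (phi_sol q hq h (s ^ 2)) (trig_sol s x 0 (1 / s)) (pint hq _)
    intervalIntegrable_const hx
  rw [phi_0, phi'_0] at w
  have e : ∀ t : ℝ, ((q t : ℂ) - s ^ 2 - -s ^ 2) * (phi q hq h (s ^ 2) t *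
      (0 * Complex.cos (s * (x - t)) + 1 / s * Complex.sin (s * (x - t)))) =
      q t * (phi q hq h (s ^ 2) t * (Complex.sin (s * (x - t)) / s)) := fun t => by ring
  simp only [e] at w
  simp only [sub_self, mul_zero, Complex.cos_zero, Complex.sin_zero, Complex.ofReal_zero, sub_zero,
    zero_mul, mul_one, zero_add, zero_sub, one_div, inv_mul_cancel₀ hs, one_mul, mul_neg,
    sub_neg_eq_add] at w
  rw [w]
  ring

lemma chi_volterra {s : ℂ} (hs : s ≠ 0) :
    chi q hq h B (s ^ 2) + s * Complex.sin (s * π) =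
      B * Complex.cos (s * π) + h * (Complex.cos (s * π) + B * (Complex.sin (s * π) / s)) +
      ∫ t in (0:ℝ)..π, q t * (phi q hq h (s ^ 2) t *
        (Complex.cos (s * (π - t)) + B * (Complex.sin (s * (π - t)) / s))) := by
  have w := wronskian (phi_sol q hq h (s ^ 2)) (trig_sol s π 1 (B / s)) (pint hq _)
    intervalIntegrable_const pi_mem_I
  rw [phi_0, phi'_0] at w
  have e : ∀ t : ℝ, ((q t : ℂ) - s ^ 2 - -s ^ 2) * (phi q hq h (s ^ 2) t *
      (1 * Complex.cos (s * (π - t)) + B / s * Complex.sin (s * (π - t)))) =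
      q t * (phi q hq h (s ^ 2) t *
        (Complex.cos (s * (π - t)) + B * (Complex.sin (s * (π - t)) / s))) := fun t => by ring
  simp only [e] at w
  simp only [sub_self, mul_zero, Complex.cos_zero, Complex.sin_zero, Complex.ofReal_zero, sub_zero,
    zero_mul, mul_one, zero_add, zero_sub, one_mul, mul_neg, add_zero, div_mul_cancel₀ _ hs,
    sub_neg_eq_add] at w
  unfold chi
  linear_combination w

/-- if `‖f t‖ ≤ K exp(τ t)`, `‖g t‖ ≤ L exp(τ (x - t))`, then the weighted integral is small. -/
lemma qbound {f g : ℝ → ℂ} {K L τ x : ℝ} (hx : x ∈ Set.Icc (0:ℝ) π) (hK : 0 ≤ K) (hL : 0 ≤ L)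
    (hf : ∀ t ∈ Set.Icc (0:ℝ) x, ‖f t‖ ≤ K * Real.exp (τ * t))
    (hg : ∀ t ∈ Set.Icc (0:ℝ) x, ‖g t‖ ≤ L * Real.exp (τ * (x - t)))
    (hq : IntervalIntegrable q volume 0 π) :
    ‖∫ t in (0:ℝ)..x, (q t : ℂ) * (f t * g t)‖ ≤ (∫ t in (0:ℝ)..π, |q t|) * (K * L) * Real.exp (τ * x) := by
  have hqn : IntervalIntegrable (fun t => |q t|) volume 0 π := hq.norm
  have h1 : ‖∫ t in (0:ℝ)..x, (q t : ℂ) * (f t * g t)‖ ≤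
      ∫ t in (0:ℝ)..x, |q t| * (K * L * Real.exp (τ * x)) := by
    apply intervalIntegral.norm_integral_le_of_norm_le hx.1
    · filter_upwards with t ht
      have ht' : t ∈ Set.Icc (0:ℝ) x := ⟨ht.1.le, ht.2⟩
      rw [norm_mul, norm_mul, Complex.norm_real, Real.norm_eq_abs]
      refine mul_le_mul_of_nonneg_left ?_ (abs_nonneg _)
      calc ‖f t‖ * ‖g t‖ ≤ (K * Real.exp (τ * t)) * (L * Real.exp (τ * (x - t))) := by
            gcongr
            · exact hf t ht'
            · exact hg t ht'
        _ = K * L * (Real.exp (τ * t) * Real.exp (τ * (x - t))) := by ring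
        _ = _ := by rw [← Real.exp_add]; ring_nf
    · exact (hqn.mono_set (uIcc_sub hx)).mul_const _
  refine h1.trans ?_
  rw [intervalIntegral.integral_mul_const, mul_assoc (∫ t in (0:ℝ)..π, |q t|)]
  refine mul_le_mul_of_nonneg_right ?_ (by positivity)
  exact intervalIntegral.integral_mono_interval le_rfl hx.1 hx.2
    (Filter.Eventually.of_forall fun _ => abs_nonneg _) hqn

lemma sin_div_le {s : ℂ} (hs : 1 ≤ ‖s‖) {r : ℝ} (hr : 0 ≤ r) :
    ‖Complex.sin (s * r) / s‖ ≤ 1 / ‖s‖ * Real.exp (|s.im| * r) := by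
  rw [norm_div, div_eq_mul_inv, mul_comm, one_div]
  gcongr
  rw [← im_bound s hr]; exact norm_sin_le' _

lemma phi_bound {s : ℂ} (hs : 2 * (∫ t in (0:ℝ)..π, |q t|) + 1 ≤ ‖s‖) {x : ℝ}
    (hx : x ∈ Set.Icc (0:ℝ) π) :
    ‖phi q hq h (s ^ 2) x‖ ≤ 2 * (1 + |h|) * Real.exp (|s.im| * x) := by
  set Q := ∫ t in (0:ℝ)..π, |q t| with hQ
  have hQ0 : 0 ≤ Q := intervalIntegral.integral_nonneg pi_pos.le (fun _ _ => abs_nonneg _)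
  have hs1 : 1 ≤ ‖s‖ := by linarith
  have hs0 : s ≠ 0 := by rintro rfl; simp at hs1; linarith
  set k := |s.im| with hk
  obtain ⟨x0, hx0, hmax⟩ := isCompact_Icc.exists_isMaxOn ⟨0, zero_mem_I⟩
    ((phi_sol q hq h (s ^ 2)).cont.norm.mul
      (by fun_prop : ContinuousOn (fun x => Real.exp (-(k * x))) (Set.Icc 0 π)))
  set M := ‖phi q hq h (s ^ 2) x0‖ * Real.exp (-(k * x0)) with hM
  have hM0 : 0 ≤ M := by positivity
  have hb : ∀ x ∈ Set.Icc (0:ℝ) π, ‖phi q hq h (s ^ 2) x‖ ≤ M * Real.exp (k * x) := by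
    intro x hx
    have h1 : ‖phi q hq h (s ^ 2) x‖ * Real.exp (-(k * x)) ≤ M := hmax hx
    calc ‖phi q hq h (s ^ 2) x‖ = ‖phi q hq h (s ^ 2) x‖ * Real.exp (-(k * x)) * Real.exp (k * x) := by
          rw [mul_assoc, ← Real.exp_add]; simp
      _ ≤ _ := by gcongr
  have h1 : ‖phi q hq h (s ^ 2) x0‖ ≤ (1 + |h| + M / 2) * Real.exp (k * x0) := by
    rw [phi_volterra hq h hs0 hx0]
    have b1 : ‖Complex.cos (s * x0)‖ ≤ Real.exp (k * x0) := by
      rw [hk, ← im_bound s hx0.1]; exact norm_cos_le' _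
    have b2 : ‖(h:ℂ) * (Complex.sin (s * x0) / s)‖ ≤ |h| * Real.exp (k * x0) := by
      rw [norm_mul, Complex.norm_real, Real.norm_eq_abs]
      gcongr
      refine (sin_div_le hs1 hx0.1).trans ?_
      have : 1 / ‖s‖ ≤ 1 := by rw [div_le_one (by linarith)]; exact hs1
      calc _ ≤ 1 * Real.exp (k * x0) := by gcongr
        _ = _ := one_mul _
    have b3 := qbound (f := phi q hq h (s ^ 2)) (g := fun t => Complex.sin (s * (x0 - t)) / s)
      (K := M) (L := 1 / ‖s‖) (τ := k) hx0 hM0 (by positivity)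
      (fun t ht => hb t ⟨ht.1, ht.2.trans hx0.2⟩)
      (fun t ht => by
        have := sin_div_le hs1 (r := x0 - t) (by linarith [ht.2])
        simpa using this) hq
    have b4 : Q * (M * (1 / ‖s‖)) ≤ M / 2 := by
      rw [mul_one_div, mul_div_assoc', div_le_div_iff₀ (by linarith) two_pos]
      nlinarith
    calc _ ≤ _ := norm_add₃_le
      _ ≤ Real.exp (k * x0) + |h| * Real.exp (k * x0) + M / 2 * Real.exp (k * x0) := by
          refine add_le_add (add_le_add b1 b2) (b3.trans ?_)
          gcongr
      _ = _ := by ring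
  have h2 : M ≤ 1 + |h| + M / 2 := by
    calc M ≤ (1 + |h| + M / 2) * Real.exp (k * x0) * Real.exp (-(k * x0)) := by
          rw [hM]; gcongr
      _ = _ := by rw [mul_assoc, ← Real.exp_add]; simp
  refine (hb x hx).trans ?_
  gcongr
  linarith

lemma chi_asymp : ∃ C, 0 ≤ C ∧ ∀ s : ℂ, 2 * (∫ t in (0:ℝ)..π, |q t|) + 1 ≤ ‖s‖ →
    ‖chi q hq h B (s ^ 2) + s * Complex.sin (s * π)‖ ≤ C * Real.exp (|s.im| * π) := by
  set Q := ∫ t in (0:ℝ)..π, |q t| with hQ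
  have hQ0 : 0 ≤ Q := intervalIntegral.integral_nonneg pi_pos.le (fun _ _ => abs_nonneg _)
  refine ⟨|B| + |h| * (1 + |B|) + Q * (2 * (1 + |h|) * (1 + |B|)), by positivity, fun s hs => ?_⟩
  have hs1 : 1 ≤ ‖s‖ := by linarith
  have hs0 : s ≠ 0 := by rintro rfl; simp at hs1; linarith
  rw [chi_volterra hq h B hs0]
  have bc : ∀ r : ℝ, 0 ≤ r → ‖Complex.cos (s * r)‖ ≤ Real.exp (|s.im| * r) := fun r hr => by
    rw [← im_bound s hr]; exact norm_cos_le' _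
  have bs : ∀ r : ℝ, 0 ≤ r → ‖Complex.sin (s * r) / s‖ ≤ Real.exp (|s.im| * r) := fun r hr => by
    refine (sin_div_le hs1 hr).trans ?_
    have : 1 / ‖s‖ ≤ 1 := by rw [div_le_one (by linarith)]; exact hs1
    calc _ ≤ 1 * Real.exp (|s.im| * r) := by gcongr
      _ = _ := one_mul _
  have bv : ∀ r : ℝ, 0 ≤ r → ‖Complex.cos (s * r) + B * (Complex.sin (s * r) / s)‖ ≤
      (1 + |B|) * Real.exp (|s.im| * r) := fun r hr => by
    refine (norm_add_le _ _).trans ?_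
    rw [norm_mul, Complex.norm_real, Real.norm_eq_abs, add_mul, one_mul]
    gcongr
    · exact bc r hr
    · exact bs r hr
  have b3 := qbound (f := phi q hq h (s ^ 2))
    (g := fun t => Complex.cos (s * (π - t)) + B * (Complex.sin (s * (π - t)) / s))
    (K := 2 * (1 + |h|)) (L := 1 + |B|) (τ := |s.im|) pi_mem_I (by positivity) (by positivity)
    (fun t ht => phi_bound hq h hs ht)
    (fun t ht => by
        have := bv (π - t) (by linarith [ht.2])
        simpa using this) hq
  refine norm_add₃_le.trans ?_
  have b1 : ‖(B:ℂ) * Complex.cos (s * π)‖ ≤ |B| * Real.exp (|s.im| * π) := by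
    rw [norm_mul, Complex.norm_real, Real.norm_eq_abs]
    gcongr
    exact bc π pi_pos.le
  have b2 : ‖(h:ℂ) * (Complex.cos (s * π) + B * (Complex.sin (s * π) / s))‖ ≤
      |h| * ((1 + |B|) * Real.exp (|s.im| * π)) := by
    rw [norm_mul, Complex.norm_real, Real.norm_eq_abs]
    gcongr
    exact bv π pi_pos.le
  calc _ ≤ _ := add_le_add (add_le_add b1 b2) b3
    _ = _ := by ring
end

lemma h0int : IntervalIntegrable (fun _ : ℝ => (0:ℝ)) volume 0 π := intervalIntegrable_const

/-- the model function -/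
def DD : ℂ → ℂ := chi (fun _ => 0) h0int 0 0

lemma DD_sq (s : ℂ) : DD (s ^ 2) = -(s * Complex.sin (s * π)) := by
  have h1 := trig_sol s 0 1 0
  have h2 := phi_sol (fun _ => 0) h0int 0 (s ^ 2)
  have e : (fun t : ℝ => (((0:ℝ)) : ℂ) - s ^ 2) = fun _ => - s ^ 2 := by ext; simp
  rw [e] at h2
  have := csol_unique h2 h1 intervalIntegrable_const zero_mem_I (by rw [phi_0]; simp)
    (by rw [phi'_0]; simp) π pi_mem_I
  unfold DD chi
  rw [this.1, this.2]
  simp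

lemma DD_deriv : HasDerivAt DD (-π) 0 := by
  have h1 : CSol (fun t : ℝ => (((0:ℝ)) : ℂ) - 0) (fun _ => 1) (fun _ => 0) :=
    ⟨fun x _ => hasDerivAt_const _ _, fun x _ => by simp⟩
  have h2 := chi_hasDerivAt (q := fun _ => 0) h0int 0 0 (l0 := 0) h1 rfl (by simp)
  have h3 := csol_unique (phi_sol (fun _ => 0) h0int 0 0) h1 (pint h0int 0) zero_mem_I
    (by rw [phi_0]) (by rw [phi'_0]; simp)
  refine h2.congr_deriv ?_
  rw [intervalIntegral.integral_congr (g := fun _ => (1:ℂ))]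
  · simp
  · intro t ht
    rw [uIcc_pi] at ht
    simp [(h3 t ht).1]

lemma IsSol.toC {q : ℝ → ℝ} {l : ℝ} {y y' : ℝ → ℝ} (hy : IsSol q l y y') :
    CSol (fun t => (q t : ℂ) - (l : ℂ)) (fun x => (y x : ℂ)) (fun x => (y' x : ℂ)) := by
  refine ⟨fun x hx => (hy.1 x hx).ofReal_comp, fun x hx => ?_⟩
  have := hy.2 x hx
  simp only []
  rw [this]
  push_cast
  rw [← intervalIntegral.integral_ofReal]
  push_cast
  rfl

lemma CSol.reSol {q : ℝ → ℝ} (hq : IntervalIntegrable q volume 0 π) {l : ℝ} {y y' : ℝ → ℂ}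
    (hy : CSol (fun t => (q t : ℂ) - (l : ℂ)) y y') :
    IsSol q l (fun x => (y x).re) (fun x => (y' x).re) := by
  refine ⟨fun x hx => ?_, fun x hx => ?_⟩
  · exact (Complex.reCLM.hasFDerivAt.comp_hasDerivAt x (hy.1 x hx))
  · simp only []
    rw [hy.2 x hx, Complex.add_re]
    congr 1
    have := Complex.reCLM.intervalIntegral_comp_comm
      ((hy.int (pint hq l)).mono_set (uIcc_sub hx))
    simp only [Complex.reCLM_apply] at this
    rw [← this]
    congr 1; ext t
    rw [← Complex.ofReal_sub, Complex.re_ofReal_mul]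

lemma CSol.conj {q : ℝ → ℝ} (hq : IntervalIntegrable q volume 0 π) {l : ℂ} {y y' : ℝ → ℂ}
    (hy : CSol (fun t => (q t : ℂ) - l) y y') :
    CSol (fun t => (q t : ℂ) - (starRingEnd ℂ) l) (fun x => (starRingEnd ℂ) (y x))
      (fun x => (starRingEnd ℂ) (y' x)) := by
  refine ⟨fun x hx => ?_, fun x hx => ?_⟩
  · exact (Complex.conjCLE.hasFDerivAt.comp_hasDerivAt x (hy.1 x hx))
  · simp only []
    rw [hy.2 x hx, map_add]
    congr 1
    have := Complex.conjCLE.toContinuousLinearMap.intervalIntegral_comp_comm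
      ((hy.int (pint hq l)).mono_set (uIcc_sub hx))
    simp at this
    rw [← this]

lemma int_sq_pos {f : ℝ → ℝ} (hf : ContinuousOn f (Set.Icc 0 π)) {c : ℝ}
    (hc : c ∈ Set.Icc (0:ℝ) π) (h : f c ≠ 0) : 0 < ∫ x in (0:ℝ)..π, f x ^ 2 := by
  refine intervalIntegral.integral_pos pi_pos (hf.pow 2) (fun x _ => sq_nonneg _) ⟨c, hc, by positivity⟩

section
variable {q : ℝ → ℝ} (hq : IntervalIntegrable q volume 0 π) (h B : ℝ)

lemma chi_real {l : ℂ} (hl : chi q hq h B l = 0) : l.im = 0 := by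
  have s := phi_sol q hq h l
  have w := wronskian s (s.conj hq) (pint hq _) (pint hq _) pi_mem_I
  have e0 : phi' q hq h l π = - (B * phi q hq h l π) := by unfold chi at hl; linear_combination hl
  rw [phi_0, phi'_0, e0] at w
  have e1 : ∀ t, ((q t : ℂ) - l - (q t - (starRingEnd ℂ) l)) * (phi q hq h l t * (starRingEnd ℂ) (phi q hq h l t))
      = ((starRingEnd ℂ) l - l) * ((‖phi q hq h l t‖ ^ 2 : ℝ) : ℂ) := by
    intro t; rw [Complex.mul_conj, Complex.normSq_eq_norm_sq]; ring
  simp only [e1, intervalIntegral.integral_const_mul, intervalIntegral.integral_ofReal] at w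
  simp at w
  have hp : 0 < ∫ x in (0:ℝ)..π, ‖phi q hq h l x‖ ^ 2 :=
    int_sq_pos s.cont.norm zero_mem_I (by rw [phi_0]; simp)
  have w2 : ((starRingEnd ℂ) l - l) * ((∫ x in (0:ℝ)..π, ‖phi q hq h l x‖ ^ 2 : ℝ) : ℂ) = 0 := by
    linear_combination -w
  rcases mul_eq_zero.1 w2 with h1 | h1
  · exact Complex.conj_eq_iff_im.1 (sub_eq_zero.1 h1)
  · exact absurd (Complex.ofReal_eq_zero.1 h1) hp.ne'

lemma phi_real (l x : ℝ) (hx : x ∈ Set.Icc (0:ℝ) π) :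
    phi q hq h l x = ((phi q hq h l x).re : ℂ) := by
  have s := phi_sol q hq h l
  have s2 := s.conj hq
  rw [Complex.conj_ofReal] at s2
  have := csol_unique s s2 (pint hq _) zero_mem_I (by simp [phi_0]) (by simp [phi'_0]) x hx
  exact (Complex.conj_eq_iff_re.1 this.1.symm).symm

/-- at a zero, the solution is a multiple of the terminal one -/
lemma chi_zero_mult {l : ℂ} (hl : chi q hq h B l = 0) {z z' : ℝ → ℂ}
    (hz : CSol (fun t => (q t : ℂ) - l) z z') (h1 : z π = 1) (h2 : z' π = -B) :
    ∀ x ∈ Set.Icc (0:ℝ) π, phi q hq h l x = phi q hq h l π * z x := by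
  intro x hx
  have s := phi_sol q hq h l
  have e0 : phi' q hq h l π = - (B * phi q hq h l π) := by unfold chi at hl; linear_combination hl
  have := csol_unique s (hz.lin hz (pint hq _) (phi q hq h l π) 0) (pint hq _) pi_mem_I
    (by simp [h1]) (by simp [h2, e0]; ring) x hx
  simpa using this.1

lemma chi_simple {l : ℂ} (hl : chi q hq h B l = 0) : deriv (chi q hq h B) l ≠ 0 := by
  obtain ⟨z, z', hz, h1, h2⟩ := csol_term (pint hq l) (B:ℂ)
  rw [(chi_hasDerivAt hq h B hz h1 h2).deriv]
  have him := chi_real hq h B hl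
  obtain ⟨r, rfl⟩ : ∃ r : ℝ, l = r := ⟨l.re, by apply Complex.ext <;> simp [him]⟩
  intro h0
  have hm := chi_zero_mult hq h B hl hz h1 h2
  have hp : 0 < ∫ x in (0:ℝ)..π, (phi q hq h r x).re ^ 2 :=
    int_sq_pos (Complex.continuous_re.comp_continuousOn (phi_sol q hq h r).cont) zero_mem_I (by rw [phi_0]; simp)
  have : ((∫ x in (0:ℝ)..π, (phi q hq h r x).re ^ 2 : ℝ) : ℂ) =
      phi q hq h r π * ∫ t in (0:ℝ)..π, phi q hq h r t * z t := by
    rw [← intervalIntegral.integral_ofReal, ← intervalIntegral.integral_const_mul]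
    apply intervalIntegral.integral_congr
    intro t ht
    rw [uIcc_pi] at ht
    simp only []
    rw [Complex.ofReal_pow, ← phi_real hq h r t ht, sq]
    nth_rw 2 [hm t ht]; ring
  rw [neg_eq_zero.1 h0, mul_zero] at this
  exact hp.ne' (Complex.ofReal_eq_zero.1 this)

lemma eig_iff {α β : ℝ} (hα : α ∈ Set.Ioo (0 : ℝ) π) (hβ : β ∈ Set.Ioo (0 : ℝ) π) (l : ℝ) :
    IsEigenvalue q α β l ↔ chi q hq (-Real.cot α) (Real.cot β) l = 0 := by
  have sa := Real.sin_pos_of_mem_Ioo hα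
  have sb := Real.sin_pos_of_mem_Ioo hβ
  have s := phi_sol q hq (-Real.cot α) l
  constructor
  · rintro ⟨y, y', hy, ⟨x, hx, hne⟩, b0, b1⟩
    have c0 : y' 0 = - Real.cot α * y 0 := by
      rw [Real.cot_eq_cos_div_sin]; field_simp; linarith
    have c1 : y' π = - Real.cot β * y π := by
      rw [Real.cot_eq_cos_div_sin]; field_simp; linarith
    have w := wr_const s hy.toC (pint hq _) pi_mem_I
    rw [phi_0, phi'_0, c0, c1] at w
    have hyp : y π ≠ 0 := by
      intro h0
      have := csol_zero hy.toC (pint hq _) pi_mem_I (by simp [h0]) (by simp [c1, h0]) x hx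
      exact hne (Complex.ofReal_eq_zero.1 this.1)
    have : chi q hq (-Real.cot α) (Real.cot β) l * (y π : ℂ) = 0 := by
      unfold chi; push_cast [-Complex.ofReal_cot] at w ⊢; linear_combination w
    rcases mul_eq_zero.1 this with h1 | h1
    · exact h1
    · exact absurd (Complex.ofReal_eq_zero.1 h1) hyp
  · intro hl
    refine ⟨_, _, s.reSol hq, ⟨0, zero_mem_I, by simp [phi_0]⟩, ?_, ?_⟩
    · rw [phi_0, phi'_0, Complex.ofReal_re, Complex.one_re, Real.cot_eq_cos_div_sin]
      field_simp; ring
    · have e0 : phi' q hq (-Real.cot α) l π = - ((Real.cot β : ℝ) * phi q hq (-Real.cot α) l π) := by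
        unfold chi at hl; linear_combination hl
      rw [e0, Complex.neg_re, Complex.re_ofReal_mul, Real.cot_eq_cos_div_sin β]; field_simp; ring
end

lemma factor {f : ℂ → ℂ} (hf : Differentiable ℂ f) (S : Finset ℂ) (hS : ∀ a ∈ S, f a = 0) :
    ∃ g : ℂ → ℂ, Differentiable ℂ g ∧ ∀ z, f z = (∏ a ∈ S, (z - a)) * g z := by
  induction S using Finset.induction_on with
  | empty => exact ⟨f, hf, fun z => by simp⟩
  | insert a S ha ih =>
    obtain ⟨g, hg, hfg⟩ := ih (fun b hb => hS b (Finset.mem_insert_of_mem hb))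
    have ga : g a = 0 := by
      have h1 := hS a (Finset.mem_insert_self _ _)
      rw [hfg] at h1
      rcases mul_eq_zero.1 h1 with h2 | h2
      · obtain ⟨b, hb, h3⟩ := Finset.prod_eq_zero_iff.1 h2
        exact absurd (sub_eq_zero.1 h3 ▸ hb) ha
      · exact h2
    refine ⟨dslope g a, ?_, fun z => ?_⟩
    · have := (Complex.differentiableOn_dslope (f := g) (c := a) (s := Set.univ) Filter.univ_mem).2 hg.differentiableOn
      exact differentiableOn_univ.1 this
    · have h1 := sub_smul_dslope g a z
      rw [ga, sub_zero, smul_eq_mul] at h1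
      rw [hfg, Finset.prod_insert ha, ← h1]; ring

lemma factor_ne {f g : ℂ → ℂ} (hg : Differentiable ℂ g) {S : Finset ℂ}
    (hfg : ∀ z, f z = (∏ a ∈ S, (z - a)) * g z) (hs : ∀ z, f z = 0 → deriv f z ≠ 0)
    {z : ℂ} (hz : f z = 0 → z ∈ S) : g z ≠ 0 := by
  intro h0
  have hfz : f z = 0 := by rw [hfg, h0, mul_zero]
  have hzS := hz hfz
  have hP : DifferentiableAt ℂ (fun z => ∏ a ∈ S, (z - a)) z := by fun_prop
  have hd := hP.hasDerivAt.mul (hg z).hasDerivAt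
  have e : f = (fun z => ∏ a ∈ S, (z - a)) * g := funext hfg
  rw [← e] at hd
  refine hs z hfz ?_
  rw [hd.deriv, h0, mul_zero, zero_add, Finset.prod_eq_zero hzS (sub_self z), zero_mul]

lemma count_int {f : ℂ → ℂ} (hf : Differentiable ℂ f) {S : Finset ℂ} {R : ℝ} (hR : 0 < R)
    (hS : ∀ a ∈ S, f a = 0 ∧ a ∈ Metric.ball (0:ℂ) R)
    (hS' : ∀ z ∈ Metric.closedBall (0:ℂ) R, f z = 0 → z ∈ S)
    (hs : ∀ z, f z = 0 → deriv f z ≠ 0) :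
    (∮ z in C(0, R), logDeriv f z) = S.card * (2 * π * Complex.I) := by
  obtain ⟨g, hg, hfg⟩ := factor hf S (fun a ha => (hS a ha).1)
  have gne : ∀ z ∈ Metric.closedBall (0:ℂ) R, g z ≠ 0 := fun z hz =>
    factor_ne hg hfg hs (hS' z hz)
  have hne : ∀ z ∈ Metric.sphere (0:ℂ) R, ∀ a ∈ S, z - a ≠ 0 := by
    intro z hz a ha h0
    have h1 := (hS a ha).2
    rw [← sub_eq_zero.1 h0] at h1
    simp at h1 hz
    linarith
  have e : ∀ z ∈ Metric.sphere (0:ℂ) R, logDeriv f z = (∑ a ∈ S, (z - a)⁻¹) + logDeriv g z := by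
    intro z hz
    have e0 : f = fun z => (∏ a ∈ S, (z - a)) * g z := funext hfg
    rw [e0, logDeriv_mul (f := fun z => ∏ a ∈ S, (z - a)) (g := g) z (Finset.prod_ne_zero_iff.2 (hne z hz))
      (gne z (Metric.sphere_subset_closedBall hz)) (by fun_prop) (hg z)]
    rw [logDeriv_prod (hne z hz) (fun a ha => by fun_prop)]
    congr 1
    refine Finset.sum_congr rfl fun a ha => ?_
    simp [logDeriv_apply, deriv_sub_const]
  rw [circleIntegral.integral_congr hR.le e]
  have gd : DifferentiableOn ℂ (logDeriv g) (Metric.closedBall 0 R) := by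
    intro z hz
    have : DifferentiableAt ℂ (deriv g) z := (hg.analyticAt z).deriv.differentiableAt
    exact (this.div (hg z) (gne z hz)).differentiableWithinAt
  have ci : ∀ a ∈ S, CircleIntegrable (fun z : ℂ => (z - a)⁻¹) 0 R := by
    intro a ha
    apply ContinuousOn.circleIntegrable hR.le
    exact ContinuousOn.inv₀ (by fun_prop) (fun z hz => hne z hz a ha)
  rw [circleIntegral.integral_add (CircleIntegrable.fun_sum S ci)
    ((gd.continuousOn.mono Metric.sphere_subset_closedBall).circleIntegrable hR.le)]
  rw [circleIntegral.integral_fun_sum ci]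
  rw [Finset.sum_congr rfl (fun a ha => circleIntegral.integral_sub_inv_of_mem_ball (hS a ha).2)]
  rw [Complex.circleIntegral_eq_zero_of_differentiable_on_off_countable hR.le Set.countable_empty
    gd.continuousOn (fun z hz => (gd z (Metric.ball_subset_closedBall hz.1)).differentiableAt
      (Metric.closedBall_mem_nhds_of_mem hz.1))]
  simp

lemma rouche_int {f g : ℂ → ℂ} (hf : Differentiable ℂ f) (hg : Differentiable ℂ g) {R : ℝ} (hR : 0 < R)
    (h : ∀ z ∈ Metric.sphere (0:ℂ) R, ‖f z - g z‖ < ‖g z‖) :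
    (∮ z in C(0, R), logDeriv f z) = ∮ z in C(0, R), logDeriv g z := by
  have gne : ∀ z ∈ Metric.sphere (0:ℂ) R, g z ≠ 0 := by
    intro z hz h0
    have := h z hz
    rw [h0, norm_zero] at this; exact absurd this (norm_nonneg _).not_gt
  have fne : ∀ z ∈ Metric.sphere (0:ℂ) R, f z ≠ 0 := by
    intro z hz h0
    have := h z hz
    rw [h0] at this; simp at this
  have cont : ∀ {f : ℂ → ℂ}, Differentiable ℂ f → (∀ z ∈ Metric.sphere (0:ℂ) R, f z ≠ 0) →
      CircleIntegrable (logDeriv f) 0 R := by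
    intro f hf hne
    apply ContinuousOn.circleIntegrable hR.le
    refine ContinuousOn.div ?_ hf.continuous.continuousOn hne
    exact fun z hz => (hf.analyticAt z).deriv.continuousAt.continuousWithinAt
  rw [← sub_eq_zero, ← circleIntegral.integral_sub (cont hf fne) (cont hg gne)]
  refine circleIntegral.integral_eq_zero_of_hasDerivWithinAt (f := fun z => Complex.log (f z / g z)) hR.le ?_
  intro z hz
  have hsl : f z / g z ∈ Complex.slitPlane := by
    have : ‖f z / g z - 1‖ < 1 := by
      rw [div_sub_one (gne z hz), norm_div, div_lt_one (norm_pos_iff.2 (gne z hz))]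
      exact h z hz
    left
    have h2 := (abs_lt.1 ((Complex.abs_re_le_norm _).trans_lt this)).1
    simp at h2 ⊢; linarith
  have hd := ((hf z).hasDerivAt.div (hg z).hasDerivAt (gne z hz)).clog hsl
  refine (hd.congr_deriv ?_).hasDerivWithinAt
  have := gne z hz
  have := fne z hz
  simp only [logDeriv_apply, Pi.div_apply]
  field_simp

lemma rouche_card {f g : ℂ → ℂ} (hf : Differentiable ℂ f) (hg : Differentiable ℂ g) {R : ℝ} (hR : 0 < R)
    {S T : Finset ℂ}
    (h : ∀ z ∈ Metric.sphere (0:ℂ) R, ‖f z - g z‖ < ‖g z‖)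
    (hS : ∀ a ∈ S, f a = 0 ∧ a ∈ Metric.ball (0:ℂ) R)
    (hS' : ∀ z ∈ Metric.closedBall (0:ℂ) R, f z = 0 → z ∈ S)
    (hs : ∀ z, f z = 0 → deriv f z ≠ 0)
    (hT : ∀ a ∈ T, g a = 0 ∧ a ∈ Metric.ball (0:ℂ) R)
    (hT' : ∀ z ∈ Metric.closedBall (0:ℂ) R, g z = 0 → z ∈ T)
    (ht : ∀ z, g z = 0 → deriv g z ≠ 0) : S.card = T.card := by
  have h1 := rouche_int hf hg hR h
  rw [count_int hf hR hS hS' hs, count_int hg hR hT hT' ht] at h1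
  have h2 := mul_right_cancel₀ (by simp [pi_ne_zero]) h1
  exact_mod_cast h2

lemma norm_sin_sq (z : ℂ) : ‖Complex.sin z‖ ^ 2 = Real.sin z.re ^ 2 + Real.sinh z.im ^ 2 := by
  rw [Complex.sin_eq, ← Complex.ofReal_sin, ← Complex.ofReal_cos, ← Complex.ofReal_sinh,
    ← Complex.ofReal_cosh, ← Complex.ofReal_mul, ← Complex.ofReal_mul, Complex.sq_norm,
    Complex.normSq_add_mul_I]
  have h1 := Real.cosh_sq z.im
  have h2 := Real.sin_sq_add_cos_sq z.re
  linear_combination (Real.sin z.re) ^ 2 * h1 + Real.sinh z.im ^ 2 * h2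

lemma abs_sin_pi_lower {x : ℝ} (hx : |x| ≤ 1 / 2) : 2 * |x| ≤ |Real.sin (x * π)| := by
  have h1 := Real.mul_le_sin (x := |x| * π) (by positivity) (by nlinarith [pi_pos])
  have h2 : 2 / π * (|x| * π) = 2 * |x| := by field_simp
  rw [h2] at h1
  refine h1.trans ?_
  rcases abs_cases x with ⟨h, _⟩ | ⟨h, _⟩
  · rw [h]; exact le_abs_self _
  · rw [h, neg_mul, Real.sin_neg]; exact neg_le_abs _

lemma sin_lower {s : ℂ} {N : ℕ} (hN : 1 ≤ N) (hs : ‖s‖ = N + 1 / 2) :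
    Real.exp (|s.im| * π) ≤ 20 * ‖Complex.sin (s * π)‖ := by
  have hsq := norm_sin_sq (s * π)
  have re : (s * π).re = s.re * π := by simp
  have im : (s * π).im = s.im * π := by simp
  rw [re, im] at hsq
  have hN' : (1:ℝ) ≤ N := by exact_mod_cast hN
  have hn : s.re ^ 2 + s.im ^ 2 = (N + 1 / 2) ^ 2 := by
    rw [← hs, Complex.sq_norm, Complex.normSq_apply]; ring
  have hpi := pi_gt_three
  have hpi2 := pi_lt_d2
  rcases le_or_gt (1 / 2) |s.im| with h | h
  · have h1 : |Real.sinh (s.im * π)| ≤ ‖Complex.sin (s * π)‖ := by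
      refine abs_le_of_sq_le_sq ?_ (norm_nonneg _)
      rw [hsq]; nlinarith [sq_nonneg (Real.sin (s.re * π))]
    have h2 : |Real.sinh (s.im * π)| = Real.sinh (|s.im| * π) := by
      rw [Real.abs_sinh, abs_mul, abs_of_pos pi_pos]
    rw [h2] at h1
    set x := |s.im| * π with hx
    have hx1 : 1 / 2 ≤ x := by nlinarith
    rw [Real.sinh_eq] at h1
    have h3 : Real.exp (-x) * 2 ≤ Real.exp x := by
      have : 2 ≤ Real.exp (2 * x) := by linarith [Real.add_one_le_exp (2 * x)]
      calc Real.exp (-x) * 2 ≤ Real.exp (-x) * Real.exp (2 * x) := by gcongr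
        _ = _ := by rw [← Real.exp_add]; ring_nf
    linarith [Real.exp_pos x]
  · have h0 : |s.re| ≤ N + 1 / 2 := by
      rw [← hs]; exact Complex.abs_re_le_norm s
    have h1 : N + 1 / 4 ≤ |s.re| := by
      by_contra hc
      push Not at hc
      have a1 : s.im ^ 2 < (1 / 2) ^ 2 := by rw [← sq_abs]; gcongr
      have a2 : s.re ^ 2 < (N + 1 / 4) ^ 2 := by rw [← sq_abs]; gcongr
      nlinarith
    have h2 : 1 / 2 ≤ |Real.sin (s.re * π)| := by
      have e1 : |Real.sin (s.re * π)| = |Real.sin ((|s.re| - N) * π)| := by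
        rw [sub_mul, Real.sin_sub_nat_mul_pi, abs_mul]
        simp
        rcases abs_cases s.re with ⟨h, _⟩ | ⟨h, _⟩ <;> rw [h]
        rw [neg_mul, Real.sin_neg, abs_neg]
      rw [e1]
      have hx : |(|s.re| - N)| ≤ 1 / 2 := by rw [abs_le]; constructor <;> linarith
      refine le_trans ?_ (abs_sin_pi_lower hx)
      rw [abs_of_nonneg (by linarith)]; linarith
    have h3 : |Real.sin (s.re * π)| ≤ ‖Complex.sin (s * π)‖ := by
      refine abs_le_of_sq_le_sq ?_ (norm_nonneg _)
      rw [hsq]; nlinarith [sq_nonneg (Real.sinh (s.im * π))]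
    have h4 : Real.exp (|s.im| * π) ≤ 10 := by
      calc Real.exp (|s.im| * π) ≤ Real.exp 2 := by
            gcongr; nlinarith
        _ = Real.exp 1 * Real.exp 1 := by rw [← Real.exp_add]; norm_num
        _ ≤ _ := by nlinarith [Real.exp_one_lt_d9, Real.exp_pos 1]
    linarith

lemma DD_zero_iff (z : ℂ) : DD z = 0 ↔ ∃ k : ℕ, z = ((k:ℝ) ^ 2 : ℝ) := by
  obtain ⟨s, rfl⟩ : ∃ s, z = s ^ 2 := by
    obtain ⟨s, hs⟩ := IsAlgClosed.exists_pow_nat_eq z (n := 2) (by norm_num)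
    exact ⟨s, hs.symm⟩
  rw [DD_sq, neg_eq_zero, mul_eq_zero]
  have hpi : (π : ℂ) ≠ 0 := by exact_mod_cast pi_ne_zero
  constructor
  · rintro (rfl | h)
    · exact ⟨0, by simp⟩
    · obtain ⟨k, hk⟩ := Complex.sin_eq_zero_iff.1 h
      have := mul_right_cancel₀ hpi hk
      refine ⟨k.natAbs, ?_⟩
      rw [this, Nat.cast_natAbs]
      push_cast
      norm_cast
      rw [sq_abs]
  · rintro ⟨k, hk⟩
    push_cast at hk
    right
    rw [Complex.sin_eq_zero_iff]
    rcases sq_eq_sq_iff_eq_or_eq_neg.1 hk with rfl | rfl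
    · exact ⟨k, by push_cast; ring⟩
    · exact ⟨-k, by push_cast; ring⟩

lemma DD_diff : Differentiable ℂ DD := chi_differentiable _ _ _
lemma DD_simple : ∀ z, DD z = 0 → deriv DD z ≠ 0 := fun _ hz => chi_simple _ _ _ hz

lemma ratio {f : ℂ → ℂ} {C s0 : ℝ}
    (hA : ∀ s : ℂ, s0 ≤ ‖s‖ → ‖f (s ^ 2) + s * Complex.sin (s * π)‖ ≤ C * Real.exp (|s.im| * π))
    (hC : 0 ≤ C) {N : ℕ} (hN : 1 ≤ N) (hs : s0 ≤ N) {z : ℂ}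
    (hz : ‖z‖ = ((N:ℝ) + 1 / 2) ^ 2) :
    DD z ≠ 0 ∧ ‖f z - DD z‖ ≤ 20 * C / (N + 1 / 2) * ‖DD z‖ := by
  obtain ⟨s, hs2⟩ := IsAlgClosed.exists_pow_nat_eq z (n := 2) (by norm_num)
  subst hs2
  have hn : ‖s‖ = N + 1 / 2 := by
    rw [norm_pow] at hz
    exact (pow_left_inj₀ (norm_nonneg _) (by positivity) two_ne_zero).1 hz
  have h1 := sin_lower hN hn
  have hpos := Real.exp_pos (|s.im| * π)
  have h2 := hA s (by rw [hn]; linarith)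
  rw [DD_sq]
  constructor
  · rw [neg_ne_zero]
    refine mul_ne_zero ?_ ?_
    · rw [← norm_pos_iff, hn]; positivity
    · rw [← norm_pos_iff]; linarith
  · rw [sub_neg_eq_add, norm_neg, norm_mul, hn]
    refine h2.trans ?_
    calc C * Real.exp (|s.im| * π) ≤ C * (20 * ‖Complex.sin (s * π)‖) := by gcongr
      _ = _ := by field_simp

section
variable {f : ℂ → ℂ} {ν : ℕ → ℝ} {C s0 : ℝ}

lemma nu_unbdd (hf : Differentiable ℂ f) (hν : StrictMono ν)
    (hz : ∀ z, f z = 0 ↔ ∃ k, z = (ν k : ℂ)) : Tendsto ν atTop atTop := by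
  rcases tendsto_atTop_of_monotone hν.monotone with h | ⟨L, hL⟩
  · exact h
  · exfalso
    have h1 : Tendsto (fun k => f (ν k : ℂ)) atTop (𝓝 (f (L:ℂ))) :=
      (hf.continuous.tendsto _).comp ((Complex.continuous_ofReal.tendsto _).comp hL)
    have h2 : (fun k => f (ν k : ℂ)) = fun _ => 0 := funext fun k => (hz _).2 ⟨k, rfl⟩
    rw [h2] at h1
    have h3 := tendsto_nhds_unique tendsto_const_nhds h1
    obtain ⟨k, hk⟩ := (hz _).1 h3.symm
    have hk' : L = ν k := by exact_mod_cast hk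
    have := hν.monotone.ge_of_tendsto hL (k + 1)
    have := hν (Nat.lt_succ_self k)
    simp only [Nat.succ_eq_add_one] at this
    linarith

lemma nu_count (hf : Differentiable ℂ f) (hν : StrictMono ν) (h0 : ν 0 = 0)
    (hz : ∀ z, f z = 0 ↔ ∃ k, z = (ν k : ℂ)) (hs : ∀ z, f z = 0 → deriv f z ≠ 0) {N : ℕ}
    (h : ∀ z ∈ Metric.sphere (0:ℂ) (((N:ℝ) + 1 / 2) ^ 2), ‖f z - DD z‖ < ‖DD z‖) :
    ν N < ((N:ℝ) + 1 / 2) ^ 2 ∧ ((N:ℝ) + 1 / 2) ^ 2 < ν (N + 1) := by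
  set R := ((N:ℝ) + 1 / 2) ^ 2 with hRdef
  have hR : 0 < R := by positivity
  have nn : ∀ k, 0 ≤ ν k := fun k => h0 ▸ hν.monotone (Nat.zero_le k)
  have fne : ∀ k, ν k ≠ R := by
    intro k hk
    have := h (ν k : ℂ) (by simp [abs_of_nonneg, hk, hR.le])
    rw [(hz _).2 ⟨k, rfl⟩] at this; simp at this
  have hex : ∃ M, R ≤ ν M := ((nu_unbdd hf hν hz).eventually_ge_atTop R).exists
  classical
  set M := Nat.find hex with hM
  have hM1 : R ≤ ν M := Nat.find_spec hex
  have hM2 : ∀ k, k < M → ν k < R := fun k hk => not_le.1 (Nat.find_min hex hk)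
  have iN : Function.Injective (fun k => (ν k : ℂ)) := fun a b hab => hν.injective (Complex.ofReal_injective hab)
  have iK : Function.Injective (fun k : ℕ => (((k:ℝ) ^ 2 : ℝ) : ℂ)) := fun a b hab => by
    have : (a:ℝ) ^ 2 = (b:ℝ) ^ 2 := Complex.ofReal_injective hab
    have := (pow_left_inj₀ (Nat.cast_nonneg a) (Nat.cast_nonneg b) two_ne_zero).1 this
    exact_mod_cast this
  have card := rouche_card hf DD_diff hR (S := (Finset.range M).image (fun k => (ν k : ℂ)))
    (T := (Finset.range (N + 1)).image (fun k : ℕ => (((k:ℝ) ^ 2 : ℝ) : ℂ))) h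
    (by
      intro a ha
      obtain ⟨k, hk, rfl⟩ := Finset.mem_image.1 ha
      refine ⟨(hz _).2 ⟨k, rfl⟩, ?_⟩
      have := hM2 k (Finset.mem_range.1 hk)
      simpa [abs_of_nonneg (nn k)] using this)
    (by
      intro z hzR hfz
      obtain ⟨k, rfl⟩ := (hz _).1 hfz
      have h1 : ν k ≤ R := by simpa [abs_of_nonneg (nn k)] using hzR
      refine Finset.mem_image.2 ⟨k, Finset.mem_range.2 ?_, rfl⟩
      by_contra hc
      have := hν.monotone (not_lt.1 hc)
      exact fne k (le_antisymm h1 (hM1.trans this)))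
    hs
    (by
      intro a ha
      obtain ⟨k, hk, rfl⟩ := Finset.mem_image.1 ha
      refine ⟨(DD_zero_iff _).2 ⟨k, rfl⟩, ?_⟩
      have : (k:ℝ) ≤ N := by exact_mod_cast Nat.lt_succ_iff.1 (Finset.mem_range.1 hk)
      have : (k:ℝ) ^ 2 < R := by rw [hRdef]; gcongr; linarith
      rw [mem_ball_zero_iff, Complex.norm_real, Real.norm_of_nonneg (by positivity)]; exact this)
    (by
      intro z hzR hfz
      obtain ⟨k, rfl⟩ := (DD_zero_iff _).1 hfz
      rw [mem_closedBall_zero_iff, Complex.norm_real, Real.norm_of_nonneg (by positivity)] at hzR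
      refine Finset.mem_image.2 ⟨k, Finset.mem_range.2 ?_, rfl⟩
      have h1 : (k:ℝ) ≤ N + 1 / 2 := (pow_le_pow_iff_left₀ (by positivity) (by positivity) two_ne_zero).1 hzR
      have h2 : (k:ℝ) < N + 1 := by linarith
      exact_mod_cast h2)
    DD_simple
  rw [Finset.card_image_of_injective _ iN, Finset.card_image_of_injective _ iK,
    Finset.card_range, Finset.card_range] at card
  exact ⟨hM2 N (by omega), lt_of_le_of_ne (card ▸ hM1) (fne _).symm⟩

lemma nu_loc (hf : Differentiable ℂ f) (hν : StrictMono ν) (h0 : ν 0 = 0)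
    (hz : ∀ z, f z = 0 ↔ ∃ k, z = (ν k : ℂ)) (hs : ∀ z, f z = 0 → deriv f z ≠ 0)
    (hA : ∀ s : ℂ, s0 ≤ ‖s‖ → ‖f (s ^ 2) + s * Complex.sin (s * π)‖ ≤ C * Real.exp (|s.im| * π))
    (hC : 0 ≤ C) {N : ℕ} (hN : 1 ≤ N) (hN2 : s0 ≤ N) (hN3 : 20 * C ≤ N) :
    ν N < ((N:ℝ) + 1 / 2) ^ 2 ∧ ((N:ℝ) + 1 / 2) ^ 2 < ν (N + 1) := by
  refine nu_count hf hν h0 hz hs fun z hzR => ?_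
  obtain ⟨h1, h2⟩ := ratio hA hC hN hN2 (z := z) (by simpa using hzR)
  refine h2.trans_lt ?_
  have : 20 * C / (N + 1 / 2) < 1 := by rw [div_lt_one (by positivity)]; linarith
  calc _ < 1 * ‖DD z‖ := by
        have := norm_pos_iff.2 h1
        gcongr
    _ = _ := one_mul _

lemma nu_asymp (hf : Differentiable ℂ f) (hν : StrictMono ν) (h0 : ν 0 = 0)
    (hz : ∀ z, f z = 0 ↔ ∃ k, z = (ν k : ℂ)) (hs : ∀ z, f z = 0 → deriv f z ≠ 0)
    (hA : ∀ s : ℂ, s0 ≤ ‖s‖ → ‖f (s ^ 2) + s * Complex.sin (s * π)‖ ≤ C * Real.exp (|s.im| * π))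
    (hC : 0 ≤ C) : ∃ K, 0 ≤ K ∧ ∀ k, |ν k - (k:ℝ) ^ 2| ≤ K := by
  obtain ⟨N0, hN0⟩ : ∃ N0 : ℕ, max (max 1 s0) (20 * C) ≤ N0 := exists_nat_ge _
  have hN1 : (1:ℝ) ≤ N0 := (le_max_left _ _).trans ((le_max_left _ _).trans hN0)
  have hN2 : s0 ≤ N0 := (le_max_right _ _).trans ((le_max_left _ _).trans hN0)
  have hN3 : 20 * C ≤ N0 := (le_max_right _ _).trans hN0
  have large : ∀ k, N0 + 1 ≤ k → |ν k - (k:ℝ) ^ 2| ≤ 3 * C := by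
    intro k hk
    obtain ⟨N, rfl⟩ : ∃ N, k = N + 1 := ⟨k - 1, by omega⟩
    have hNN : (N0:ℝ) ≤ N := by exact_mod_cast (by omega : N0 ≤ N)
    have hN1' : (1:ℝ) ≤ N := by linarith
    have a1 := (nu_loc hf hν h0 hz hs hA hC (N := N) (by exact_mod_cast hN1') (by linarith) (by linarith)).2
    have a2 := (nu_loc hf hν h0 hz hs hA hC (N := N + 1) (by omega) (by push_cast; linarith)
      (by push_cast; linarith)).1
    set s := √(ν (N + 1)) with hsdef
    have nn : 0 ≤ ν (N + 1) := h0 ▸ hν.monotone (Nat.zero_le _)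
    have hs2 : s ^ 2 = ν (N + 1) := Real.sq_sqrt nn
    have hs0 : 0 ≤ s := Real.sqrt_nonneg _
    rw [← hs2] at a1 a2
    have b1 : (N:ℝ) + 1 / 2 < s := lt_of_pow_lt_pow_left₀ 2 hs0 a1
    have b2 : s < ((N + 1 : ℕ) : ℝ) + 1 / 2 := lt_of_pow_lt_pow_left₀ 2 (by positivity) a2
    push_cast at b2
    have c := hA (s:ℂ) (by rw [Complex.norm_real, Real.norm_of_nonneg hs0]; linarith)
    rw [← Complex.ofReal_pow, hs2, (hz _).2 ⟨N + 1, rfl⟩, zero_add, ← Complex.ofReal_mul,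
      ← Complex.ofReal_sin, ← Complex.ofReal_mul, Complex.norm_real, Complex.ofReal_im] at c
    simp only [abs_zero, zero_mul, Real.exp_zero, mul_one, norm_mul, Real.norm_eq_abs, abs_of_nonneg hs0] at c
    have d : 2 * |s - ((N + 1 : ℕ) : ℝ)| ≤ |Real.sin (s * π)| := by
      have := abs_sin_pi_lower (x := s - ((N + 1 : ℕ) : ℝ)) (by
        push_cast; rw [abs_le]; constructor <;> linarith)
      rw [sub_mul, Real.sin_sub_nat_mul_pi, abs_mul] at this
      simpa using this
    have e : ν (N + 1) - ((N + 1 : ℕ) : ℝ) ^ 2 = (s - ((N + 1 : ℕ) : ℝ)) * (s + ((N + 1 : ℕ) : ℝ)) := by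
      rw [← hs2]; ring
    rw [e, abs_mul, abs_of_nonneg (a := s + ((N + 1 : ℕ) : ℝ)) (by positivity)]
    have g : s + ((N + 1 : ℕ) : ℝ) ≤ 3 * s := by push_cast; linarith
    calc |s - ((N + 1 : ℕ) : ℝ)| * (s + ((N + 1 : ℕ) : ℝ)) ≤ |Real.sin (s * π)| * (3 * s) := by
          refine mul_le_mul ?_ g (by positivity) (abs_nonneg _)
          linarith [abs_nonneg (s - ((N + 1 : ℕ) : ℝ))]
      _ ≤ 3 * C := by linarith
  refine ⟨3 * C + ∑ k ∈ Finset.range (N0 + 1), |ν k - (k:ℝ) ^ 2|, by positivity, fun k => ?_⟩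
  rcases lt_or_ge k (N0 + 1) with h | h
  · have := Finset.single_le_sum (f := fun k : ℕ => |ν k - (k:ℝ) ^ 2|) (fun _ _ => abs_nonneg _)
      (Finset.mem_range.2 h)
    linarith
  · have := large k h
    have : 0 ≤ ∑ k ∈ Finset.range (N0 + 1), |ν k - (k:ℝ) ^ 2| := Finset.sum_nonneg fun _ _ => abs_nonneg _
    linarith
end

lemma factor_seq {f : ℂ → ℂ} (hf : Differentiable ℂ f) {c : ℕ → ℂ} (hc : Function.Injective c)
    (n : ℕ) (hz : ∀ k, f (c k) = 0) (hs : ∀ z, f z = 0 → deriv f z ≠ 0) :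
    ∃ F : ℂ → ℂ, Differentiable ℂ F ∧ (∀ z, f z = (∏ k ∈ Finset.range n, (z - c k)) * F z) ∧
      ∀ z, (f z = 0 → ∃ k < n, z = c k) → F z ≠ 0 := by
  classical
  obtain ⟨F, hF, hfF⟩ := factor hf ((Finset.range n).image c) (by
    intro a ha
    obtain ⟨k, _, rfl⟩ := Finset.mem_image.1 ha
    exact hz k)
  refine ⟨F, hF, fun z => ?_, fun z hz => factor_ne hF hfF hs ?_⟩
  · rw [hfF, Finset.prod_image (fun a _ b _ hab => hc hab)]
  · intro h0
    obtain ⟨k, hk, e⟩ := hz h0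
    exact Finset.mem_image.2 ⟨k, Finset.mem_range.2 hk, e.symm⟩

lemma deriv_at {f F : ℂ → ℂ} (hF : Differentiable ℂ F) {c : ℕ → ℂ} (h0 : c 0 = 0) {N : ℕ}
    (hf : ∀ z, f z = (∏ k ∈ Finset.range (N + 1), (z - c k)) * F z) :
    deriv f 0 = (∏ k ∈ Finset.range N, (- c (k + 1))) * F 0 := by
  have e : f = (fun z => z) * (fun z => (∏ k ∈ Finset.range N, (z - c (k + 1))) * F z) := by
    ext z
    rw [hf, Finset.prod_range_succ', h0]
    simp only [Pi.mul_apply]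
    ring
  have hd : DifferentiableAt ℂ (fun z => (∏ k ∈ Finset.range N, (z - c (k + 1))) * F z) 0 := by
    fun_prop
  have := (hasDerivAt_id (0:ℂ)).mul hd.hasDerivAt
  rw [e]
  have h2 := this.deriv
  simp only [id] at h2
  rw [show ((fun z : ℂ => z) * fun z => (∏ k ∈ Finset.range N, (z - c (k + 1))) * F z) =
    (id * fun z => (∏ k ∈ Finset.range N, (z - c (k + 1))) * F z) from rfl]
  rw [this.deriv]
  simp

lemma sigma_tendsto : Tendsto (fun N : ℕ => ∑ k ∈ Finset.range (N + 1), 1 / (((N:ℝ) + 1 / 2) ^ 2 - (k:ℝ) ^ 2))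
    atTop (𝓝 0) := by
  have hu : Tendsto (fun j : ℕ => 1 / ((j:ℝ) + 1 / 2)) atTop (𝓝 0) := by
    refine tendsto_const_nhds.div_atTop ?_
    exact tendsto_atTop_add_const_right _ _ tendsto_natCast_atTop_atTop
  have hc := (hu.cesaro.comp (tendsto_add_atTop_nat 1)).const_mul 2
  rw [mul_zero] at hc
  refine squeeze_zero (fun N => Finset.sum_nonneg fun k hk => ?_) (fun N => ?_) hc
  · have : (k:ℝ) ≤ N := by exact_mod_cast Nat.lt_succ_iff.1 (Finset.mem_range.1 hk)
    have : (k:ℝ) ^ 2 ≤ ((N:ℝ) + 1 / 2) ^ 2 := by gcongr; linarith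
    exact div_nonneg zero_le_one (by linarith)
  · simp only [Function.comp]
    rw [← Finset.sum_range_reflect, ← mul_assoc, Finset.mul_sum]
    refine Finset.sum_le_sum fun k hk => ?_
    have hk' : k ≤ N := Nat.lt_succ_iff.1 (Finset.mem_range.1 hk)
    have hkr : (k:ℝ) ≤ N := by exact_mod_cast hk'
    have e : ((N + 1 - 1 - k : ℕ) : ℝ) = N - k := by
      rw [Nat.add_sub_cancel, Nat.cast_sub hk']
    rw [e]
    have h1 : 1 / (((N:ℝ) + 1 / 2) ^ 2 - ((N:ℝ) - k) ^ 2) ≤ 1 / (((N:ℝ) + 1) / 2 * ((k:ℝ) + 1 / 2)) := by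
      apply one_div_le_one_div_of_le (by positivity)
      have h0 : (0:ℝ) ≤ k := Nat.cast_nonneg k
      nlinarith
    refine h1.trans (le_of_eq ?_)
    push_cast
    field_simp

section
variable {f : ℂ → ℂ} {ν : ℕ → ℝ} {C s0 : ℝ}

lemma G_sphere {K : ℝ} (hK : 0 ≤ K) (hνK : ∀ k, |ν k - (k:ℝ) ^ 2| ≤ K)
    (hA : ∀ s : ℂ, s0 ≤ ‖s‖ → ‖f (s ^ 2) + s * Complex.sin (s * π)‖ ≤ C * Real.exp (|s.im| * π))
    (hC : 0 ≤ C) {N : ℕ} (hN : 1 ≤ N) (hN2 : s0 ≤ N) (hN3 : 40 * C ≤ N)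
    {z F D : ℂ} (hz : ‖z‖ = ((N:ℝ) + 1 / 2) ^ 2) (hF : f z = (∏ k ∈ Finset.range (N + 1), (z - ν k)) * F)
    (hD : DD z = (∏ k ∈ Finset.range (N + 1), (z - ((k:ℝ) ^ 2 : ℝ))) * D) :
    ‖D / F - 1‖ ≤ (1 + 2 * (20 * C / (N + 1 / 2))) *
      Real.exp (K * ∑ k ∈ Finset.range (N + 1), 1 / (((N:ℝ) + 1 / 2) ^ 2 - (k:ℝ) ^ 2)) - 1 := by
  obtain ⟨r1, r2⟩ := ratio hA hC hN hN2 hz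
  set ε := 20 * C / ((N:ℝ) + 1 / 2) with hε
  have hε0 : 0 ≤ ε := by positivity
  have hε1 : ε ≤ 1 / 2 := by rw [hε, div_le_iff₀ (by positivity)]; linarith
  have hDp := norm_pos_iff.2 r1
  have hfl : 1 / 2 * ‖DD z‖ ≤ ‖f z‖ := by
    have := norm_sub_norm_le (DD z) (f z)
    rw [norm_sub_rev] at this
    nlinarith
  have hf0 : f z ≠ 0 := norm_pos_iff.1 (by linarith)
  have pD : ∀ k ∈ Finset.range (N + 1), z - (((k:ℝ) ^ 2 : ℝ) : ℂ) ≠ 0 := by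
    intro k hk
    have := r1; rw [hD] at this
    exact Finset.prod_ne_zero_iff.1 (left_ne_zero_of_mul this) k hk
  have pF : (∏ k ∈ Finset.range (N + 1), (z - ν k)) ≠ 0 := by
    have := hf0; rw [hF] at this; exact left_ne_zero_of_mul this
  have pF' : F ≠ 0 := by
    have := hf0; rw [hF] at this; exact right_ne_zero_of_mul this
  have pD' := Finset.prod_ne_zero_iff.2 pD
  set σ := K * ∑ k ∈ Finset.range (N + 1), 1 / (((N:ℝ) + 1 / 2) ^ 2 - (k:ℝ) ^ 2) with hσ
  set P : ℂ := ∏ k ∈ Finset.range (N + 1), (1 + (((k:ℝ) ^ 2 : ℝ) - ν k : ℂ) / (z - ((k:ℝ) ^ 2 : ℝ))) with hP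
  have hPe : P = (∏ k ∈ Finset.range (N + 1), (z - ν k)) / (∏ k ∈ Finset.range (N + 1), (z - (((k:ℝ) ^ 2 : ℝ) : ℂ))) := by
    rw [hP, ← Finset.prod_div_distrib]
    refine Finset.prod_congr rfl fun k hk => ?_
    have := pD k hk
    field_simp
    ring
  have e : D / F = DD z / f z * P := by
    rw [hPe, hF, hD]; field_simp
  have hsum : ∑ k ∈ Finset.range (N + 1), ‖(((k:ℝ) ^ 2 : ℝ) - ν k : ℂ) / (z - ((k:ℝ) ^ 2 : ℝ))‖ ≤ σ := by
    rw [hσ, Finset.mul_sum]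
    refine Finset.sum_le_sum fun k hk => ?_
    have hkN : (k:ℝ) ≤ N := by exact_mod_cast Nat.lt_succ_iff.1 (Finset.mem_range.1 hk)
    have hlt : (k:ℝ) ^ 2 < ((N:ℝ) + 1 / 2) ^ 2 := by gcongr; linarith
    rw [norm_div, ← Complex.ofReal_sub, Complex.norm_real, Real.norm_eq_abs, abs_sub_comm, mul_one_div]
    have h1 := norm_sub_norm_le z (((k:ℝ) ^ 2 : ℝ) : ℂ)
    rw [hz, Complex.norm_real, Real.norm_of_nonneg (by positivity)] at h1
    exact div_le_div₀ hK (hνK k) (by linarith) h1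
  have hP1 : ‖P - 1‖ ≤ Real.exp σ - 1 := by
    refine (Finset.norm_prod_one_add_sub_one_le _ _).trans ?_
    gcongr
  have hP2 : ‖P‖ ≤ Real.exp σ := by
    have := norm_sub_norm_le P 1
    rw [norm_one] at this; linarith
  have hr : ‖DD z / f z - 1‖ ≤ 2 * ε := by
    rw [div_sub_one hf0, norm_div, div_le_iff₀ (by linarith), norm_sub_rev]
    nlinarith
  rw [e]
  calc ‖DD z / f z * P - 1‖ = ‖(DD z / f z - 1) * P + (P - 1)‖ := by ring_nf
    _ ≤ ‖DD z / f z - 1‖ * ‖P‖ + ‖P - 1‖ := by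
        refine (norm_add_le _ _).trans ?_; rw [norm_mul]
    _ ≤ 2 * ε * Real.exp σ + (Real.exp σ - 1) := by gcongr
    _ = _ := by ring

lemma prod_lim (hf : Differentiable ℂ f) (hν : StrictMono ν) (h0 : ν 0 = 0)
    (hz : ∀ z, f z = 0 ↔ ∃ k, z = (ν k : ℂ)) (hs : ∀ z, f z = 0 → deriv f z ≠ 0)
    (hA : ∀ s : ℂ, s0 ≤ ‖s‖ → ‖f (s ^ 2) + s * Complex.sin (s * π)‖ ≤ C * Real.exp (|s.im| * π))
    (hC : 0 ≤ C) : Tendsto (fun N : ℕ => ((∏ k ∈ Finset.range N, ν (k + 1) / ((k:ℝ) + 1) ^ 2 : ℝ) : ℂ))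
      atTop (𝓝 (- deriv f 0 / π)) := by
  obtain ⟨K, hK, hνK⟩ := nu_asymp hf hν h0 hz hs hA hC
  have hd0 : deriv f 0 ≠ 0 := hs 0 ((hz 0).2 ⟨0, by simp [h0]⟩)
  have hpi : (π : ℂ) ≠ 0 := by exact_mod_cast pi_ne_zero
  have iN : Function.Injective (fun k => (ν k : ℂ)) := fun a b hab => hν.injective (Complex.ofReal_injective hab)
  have iK : Function.Injective (fun k : ℕ => (((k:ℝ) ^ 2 : ℝ) : ℂ)) := fun a b hab => by
    have : (a:ℝ) ^ 2 = (b:ℝ) ^ 2 := Complex.ofReal_injective hab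
    have := (pow_left_inj₀ (Nat.cast_nonneg a) (Nat.cast_nonneg b) two_ne_zero).1 this
    exact_mod_cast this
  have nn : ∀ k, 0 ≤ ν k := fun k => h0 ▸ hν.monotone (Nat.zero_le k)
  have key : ∀ N : ℕ, max (max 1 s0) (40 * C) ≤ N →
      ‖(-π / deriv f 0) * ((∏ k ∈ Finset.range N, ν (k + 1) / ((k:ℝ) + 1) ^ 2 : ℝ) : ℂ) - 1‖ ≤
      (1 + 2 * (20 * C / (N + 1 / 2))) *
      Real.exp (K * ∑ k ∈ Finset.range (N + 1), 1 / (((N:ℝ) + 1 / 2) ^ 2 - (k:ℝ) ^ 2)) - 1 := by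
    intro N hN0
    have hN1 : (1:ℝ) ≤ N := (le_max_left _ _).trans ((le_max_left _ _).trans hN0)
    have hN2 : s0 ≤ N := (le_max_right _ _).trans ((le_max_left _ _).trans hN0)
    have hN3 : 40 * C ≤ N := (le_max_right _ _).trans hN0
    have hN1' : 1 ≤ N := by exact_mod_cast hN1
    obtain ⟨F, dF, eF, nF⟩ := factor_seq hf iN (N + 1) (fun k => (hz _).2 ⟨k, rfl⟩) hs
    obtain ⟨D, dD, eD, nD⟩ := factor_seq DD_diff iK (N + 1) (fun k => (DD_zero_iff _).2 ⟨k, rfl⟩) DD_simple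
    have loc := nu_loc hf hν h0 hz hs hA hC hN1' hN2 (by linarith)
    set R := ((N:ℝ) + 1 / 2) ^ 2 with hR
    have hRpos : 0 < R := by positivity
    have Fne : ∀ z ∈ Metric.closedBall (0:ℂ) R, F z ≠ 0 := by
      intro z hzR
      refine nF z fun hfz => ?_
      obtain ⟨k, rfl⟩ := (hz _).1 hfz
      refine ⟨k, ?_, rfl⟩
      have h1 : ν k ≤ R := by simpa [abs_of_nonneg (nn k)] using hzR
      exact hν.lt_iff_lt.1 (h1.trans_lt loc.2)
    have hG := Complex.norm_le_of_forall_mem_frontier_norm_le (f := fun z => D z / F z - 1)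
      (U := Metric.ball (0:ℂ) R) (z := 0) (C := (1 + 2 * (20 * C / (N + 1 / 2))) *
      Real.exp (K * ∑ k ∈ Finset.range (N + 1), 1 / (((N:ℝ) + 1 / 2) ^ 2 - (k:ℝ) ^ 2)) - 1)
      Metric.isBounded_ball (by
        apply DifferentiableOn.diffContOnCl
        rw [closure_ball _ hRpos.ne']
        exact ((dD.differentiableOn).div dF.differentiableOn Fne).sub_const _) (by
        intro z hzf
        rw [frontier_ball _ hRpos.ne', mem_sphere_zero_iff_norm] at hzf
        exact G_sphere hK hνK hA hC hN1' hN2 hN3 hzf (eF z) (eD z))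
      (subset_closure (Metric.mem_ball_self hRpos))
    have d1 := deriv_at dF (by simp [h0]) eF
    have d2 := deriv_at dD (by simp) eD
    rw [DD_deriv.deriv] at d2
    suffices hsuf : (-π / deriv f 0) * ((∏ k ∈ Finset.range N, ν (k + 1) / ((k:ℝ) + 1) ^ 2 : ℝ) : ℂ) = D 0 / F 0 by
      rw [hsuf]; exact hG
    have F0 := Fne 0 (Metric.mem_closedBall_self hRpos.le)
    have p1 : (∏ k ∈ Finset.range N, (-((((k + 1 : ℕ):ℝ) ^ 2 : ℝ) : ℂ))) ≠ 0 := by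
      intro h1; rw [h1, zero_mul] at d2; exact hpi (neg_eq_zero.1 d2)
    have p2 : (∏ k ∈ Finset.range N, (-(ν (k + 1) : ℂ))) ≠ 0 := by
      intro h1; rw [h1, zero_mul] at d1; exact hd0 d1
    have e3 : ((∏ k ∈ Finset.range N, ν (k + 1) / ((k:ℝ) + 1) ^ 2 : ℝ) : ℂ) =
        (∏ k ∈ Finset.range N, (-(ν (k + 1) : ℂ))) / ∏ k ∈ Finset.range N, (-((((k + 1 : ℕ):ℝ) ^ 2 : ℝ) : ℂ)) := by
      rw [← Finset.prod_div_distrib, Complex.ofReal_prod]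
      refine Finset.prod_congr rfl fun k _ => ?_
      rw [neg_div_neg_eq]; push_cast; rfl
    rw [e3, d1, d2]
    field_simp
  have lim0 : Tendsto (fun N : ℕ => (1 + 2 * (20 * C / ((N:ℝ) + 1 / 2))) *
      Real.exp (K * ∑ k ∈ Finset.range (N + 1), 1 / (((N:ℝ) + 1 / 2) ^ 2 - (k:ℝ) ^ 2)) - 1) atTop (𝓝 0) := by
    have a1 : Tendsto (fun N : ℕ => 20 * C / ((N:ℝ) + 1 / 2)) atTop (𝓝 0) :=
      tendsto_const_nhds.div_atTop (tendsto_atTop_add_const_right _ _ tendsto_natCast_atTop_atTop)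
    have a2 := (Real.continuous_exp.tendsto _).comp (sigma_tendsto.const_mul K)
    have := (((a1.const_mul 2).const_add 1).mul a2).sub_const 1
    simpa using this
  have lim1 : Tendsto (fun N : ℕ => (-π / deriv f 0) * ((∏ k ∈ Finset.range N, ν (k + 1) / ((k:ℝ) + 1) ^ 2 : ℝ) : ℂ))
      atTop (𝓝 1) := by
    rw [tendsto_iff_norm_sub_tendsto_zero]
    refine squeeze_zero' (Filter.Eventually.of_forall fun _ => norm_nonneg _) ?_ lim0
    filter_upwards [tendsto_natCast_atTop_atTop.eventually_ge_atTop (max (max 1 s0) (40 * C))] with N hN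
    exact key N hN
  have := lim1.const_mul (- deriv f 0 / π)
  rw [mul_one] at this
  refine this.congr fun N => ?_
  rw [← mul_assoc]
  have : -deriv f 0 / π * (-π / deriv f 0) = 1 := by field_simp
  rw [this, one_mul]
end

lemma IsSol.shift {q : ℝ → ℝ} {l m : ℝ} {y y' : ℝ → ℝ} (c : ℝ) (h : IsSol q l y y') (hm : m = l - c) :
    IsSol (fun t => q t - c) m y y' := by
  subst hm
  refine ⟨h.1, fun x hx => ?_⟩
  rw [h.2 x hx]
  congr 2; ext t; ring

lemma eig_shift {q : ℝ → ℝ} {α β l m : ℝ} (c : ℝ) (hm : m = l - c) :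
    IsEigenvalue (fun t => q t - c) α β m ↔ IsEigenvalue q α β l := by
  constructor
  · rintro ⟨y, y', h, r⟩
    refine ⟨y, y', ?_, r⟩
    have := h.shift (-c) (m := l) (by linarith)
    simpa using this
  · rintro ⟨y, y', h, r⟩
    exact ⟨y, y', h.shift c hm, r⟩
theorem statement13 (q : ℝ → ℝ) (hq : IntegrableOn q (Set.Icc (0 : ℝ) π))
    (α β : ℝ) (hα : α ∈ Set.Ioo (0 : ℝ) π) (hβ : β ∈ Set.Ioo (0 : ℝ) π)
    (μ : ℕ → ℝ) (hmono : StrictMono μ)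
    (henum : ∀ lam : ℝ, IsEigenvalue q α β lam ↔ ∃ n : ℕ, μ n = lam)
    (Φ Φ' Ψ Ψ' : ℕ → ℝ → ℝ)
    (hΦ : ∀ n : ℕ, IsSol q (μ n) (Φ n) (Φ' n))
    (hΦ0 : ∀ n : ℕ, Φ n 0 = 1) (hΦ'0 : ∀ n : ℕ, Φ' n 0 = -Real.cot α)
    (hΨ : ∀ n : ℕ, IsSol q (μ n) (Ψ n) (Ψ' n))
    (hΨπ : ∀ n : ℕ, Ψ n π = 1) (hΨ'π : ∀ n : ℕ, Ψ' n π = -Real.cot β)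
    (a b : ℕ → ℝ)
    (ha : ∀ n : ℕ, a n = ∫ x in (0 : ℝ)..π, (Φ n x) ^ 2)
    (hb : ∀ n : ℕ, b n = ∫ x in (0 : ℝ)..π, (Ψ n x) ^ 2) :
    Multipliable (fun k : ℕ => (μ (k + 1) - μ 0) / ((k : ℝ) + 1) ^ 2) ∧
      1 / b 0 = a 0 / (π ^ 2 * (∏' k : ℕ, (μ (k + 1) - μ 0) / ((k : ℝ) + 1) ^ 2) ^ 2) := by
  have hqi : IntervalIntegrable q volume 0 π := by
    rw [intervalIntegrable_iff_integrableOn_Icc_of_le pi_pos.le]; exact hq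
  set c := μ 0 with hc
  have hQ : IntervalIntegrable (fun t => q t - c) volume 0 π := hqi.sub intervalIntegrable_const
  set f := chi (fun t => q t - c) hQ (-Real.cot α) (Real.cot β) with hfdef
  set ν : ℕ → ℝ := fun k => μ k - c with hνdef
  have hν : StrictMono ν := fun a b hab => sub_lt_sub_right (hmono hab) _
  have h0 : ν 0 = 0 := sub_self _
  have hfd : Differentiable ℂ f := chi_differentiable _ _ _
  have hz : ∀ z, f z = 0 ↔ ∃ k, z = (ν k : ℂ) := by
    intro z
    have hreal : ∀ r : ℝ, f r = 0 ↔ ∃ k, r = ν k := by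
      intro r
      rw [hfdef, ← eig_iff hQ hα hβ, eig_shift c (l := r + c) (by ring), henum]
      constructor
      · rintro ⟨n, hn⟩; exact ⟨n, by simp only [hνdef]; linarith⟩
      · rintro ⟨n, hn⟩; exact ⟨n, by simp only [hνdef] at hn; linarith⟩
    constructor
    · intro hfz
      have him := chi_real _ _ _ hfz
      obtain ⟨r, rfl⟩ : ∃ r : ℝ, z = r := ⟨z.re, by apply Complex.ext <;> simp [him]⟩
      obtain ⟨k, hk⟩ := (hreal r).1 hfz
      exact ⟨k, by rw [hk]⟩
    · rintro ⟨k, rfl⟩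
      exact (hreal _).2 ⟨k, rfl⟩
  have hs : ∀ z, f z = 0 → deriv f z ≠ 0 := fun z hfz => chi_simple _ _ _ hfz
  obtain ⟨C, hC, hA⟩ := chi_asymp hQ (-Real.cot α) (Real.cot β)
  have hlim := prod_lim hfd hν h0 hz hs hA hC
  obtain ⟨K, hK, hνK⟩ := nu_asymp hfd hν h0 hz hs hA hC
  have hmul : Multipliable (fun k : ℕ => (μ (k + 1) - c) / ((k : ℝ) + 1) ^ 2) := by
    have e : (fun k : ℕ => (μ (k + 1) - c) / ((k : ℝ) + 1) ^ 2) =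
        fun k : ℕ => 1 + (ν (k + 1) - ((k + 1 : ℕ) : ℝ) ^ 2) / ((k + 1 : ℕ) : ℝ) ^ 2 := by
      ext k
      simp only [hνdef]
      push_cast
      field_simp
      ring
    rw [e]
    apply multipliable_one_add_of_summable
    have hsum : Summable (fun k : ℕ => K * (1 / ((k + 1 : ℕ) : ℝ) ^ 2)) :=
      ((summable_nat_add_iff 1).2 (Real.summable_one_div_nat_pow.2 one_lt_two)).mul_left K
    refine Summable.of_nonneg_of_le (fun _ => norm_nonneg _) (fun k => ?_) hsum
    rw [norm_div, Real.norm_eq_abs, Real.norm_of_nonneg (by positivity), mul_one_div]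
    gcongr
    exact hνK (k + 1)
  refine ⟨hmul, ?_⟩
  set P := ∏' k : ℕ, (μ (k + 1) - c) / ((k : ℝ) + 1) ^ 2 with hP
  have hPlim := hmul.hasProd.tendsto_prod_nat
  have hPc : (P : ℂ) = - deriv f 0 / π :=
    tendsto_nhds_unique ((Complex.continuous_ofReal.tendsto _).comp hPlim) hlim
  -- the solutions at the lowest eigenvalue
  have sΦ := ((hΦ 0).shift c (m := 0) (by simp [hc])).toC
  have sΨ := ((hΨ 0).shift c (m := 0) (by simp [hc])).toC
  have hf0 : f ((0:ℝ):ℂ) = 0 := (hz _).2 ⟨0, by rw [h0]⟩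
  have hpp := phi_sol (fun t => q t - c) hQ (-Real.cot α) ((0:ℝ):ℂ)
  have hphi : ∀ x ∈ Set.Icc (0:ℝ) π, phi (fun t => q t - c) hQ (-Real.cot α) ((0:ℝ):ℂ) x = Φ 0 x := by
    intro x hx
    exact (csol_unique hpp sΦ (pint hQ _) zero_mem_I (by rw [phi_0]; simp [hΦ0])
      (by rw [phi'_0]; simp only [hΦ'0]) x hx).1
  have hm := chi_zero_mult hQ (-Real.cot α) (Real.cot β) hf0 sΨ (by simp [hΨπ])
    (by simp only [hΨ'π]; push_cast; rfl)
  have hm' : ∀ x ∈ Set.Icc (0:ℝ) π, Φ 0 x = Φ 0 π * Ψ 0 x := by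
    intro x hx
    have := hm x hx
    rw [hphi x hx, hphi π pi_mem_I] at this
    exact_mod_cast this
  have hder := chi_hasDerivAt hQ (-Real.cot α) (Real.cot β) sΨ (by simp [hΨπ])
    (by simp only [hΨ'π]; push_cast; rfl)
  have cΨ : ContinuousOn (Ψ 0) (Set.Icc 0 π) := fun x hx =>
    ((hΨ 0).1 x hx).continuousAt.continuousWithinAt
  have hb0 : 0 < b 0 := by
    rw [hb]
    exact int_sq_pos cΨ pi_mem_I (by rw [hΨπ]; exact one_ne_zero)
  have hκ : Φ 0 π ≠ 0 := by
    intro h1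
    have := hm' 0 zero_mem_I
    rw [h1, hΦ0] at this; simp at this
  have ha0 : a 0 = (Φ 0 π) ^ 2 * b 0 := by
    rw [ha, hb, ← intervalIntegral.integral_const_mul]
    apply intervalIntegral.integral_congr
    intro x hx
    rw [uIcc_pi] at hx
    simp only []
    rw [hm' x hx]; ring
  have hI : (∫ t in (0:ℝ)..π, phi (fun t => q t - c) hQ (-Real.cot α) ((0:ℝ):ℂ) t * (Ψ 0 t : ℂ)) =
      ((Φ 0 π * b 0 : ℝ) : ℂ) := by
    rw [hb, ← intervalIntegral.integral_const_mul, ← intervalIntegral.integral_ofReal]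
    apply intervalIntegral.integral_congr
    intro x hx
    rw [uIcc_pi] at hx
    simp only []
    rw [hphi x hx, hm' x hx]; push_cast; ring
  rw [hI] at hder
  have hd0 : deriv f 0 = -((Φ 0 π * b 0 : ℝ) : ℂ) := by
    have := hder.deriv
    rw [Complex.ofReal_zero] at this
    exact this
  have hPr : P = Φ 0 π * b 0 / π := by
    rw [hd0, neg_neg] at hPc
    exact_mod_cast hPc
  rw [hPr, ha0]
  have := pi_ne_zero
  field_simp
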